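/- arXiv:2512.10827 — 2 statements merged into one kernel-verified Lean document; each statement's English description precedes it below -/
import Mathlib

section
/- Let G be a finite simple graph and let S ⊆ V(G) be a set attaining the maximum of sun(G − S') − 2|S'| over all S' ⊆ V(G). If D is a connected component of G − S that is not a sun, then D has a {P₃, P₄, P₅}-factor. -/
/-- `H` is (isomorphic to) a path on `n` vertices. -/
def IsPathOn {W : Type*} (H : SimpleGraph W) (n : ℕ) : Prop :=
  Nonempty (H ≃g SimpleGraph.pathGraph n)

/-- A graph is factor-critical if deleting any vertex leaves a graph with a perfect
matching. -/
def IsFactorCritical {W : Type*} (R : SimpleGraph W) : Prop :=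
  ∀ x : W, ∃ M : (R.induce {y : W | y ≠ x}).Subgraph, M.IsPerfectMatching

/-- `H` is a sun: `H = K₁`, `H = K₂`, or `H` is obtained from a factor-critical graph `R`
(its core, here an induced subgraph on a vertex set `R`) by attaching to each core vertex
`v` a pendant vertex `p v` whose unique neighbor is `v`. -/
def IsSun {W : Type*} (H : SimpleGraph W) : Prop :=
  Nat.card W = 1 ∨
  (Nat.card W = 2 ∧ ∀ u v : W, u ≠ v → H.Adj u v) ∨
  ∃ (R : Set W) (p : R ≃ (Rᶜ : Set W)),
    IsFactorCritical (H.induce R) ∧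
    (∀ v : R, H.Adj (↑v) (↑(p v))) ∧
    (∀ u : (Rᶜ : Set W), ∀ x : W, H.Adj (↑u) x ↔ x = ↑(p.symm u))

/-- The number of connected components of `G − S` that are suns. -/
noncomputable def sunCount {V : Type*} [Fintype V] (G : SimpleGraph V) (S : Set V) : ℕ :=
  Nat.card {c : (G.induce Sᶜ).ConnectedComponent //
    IsSun ((G.induce Sᶜ).induce c.supp)}

/-- `H` has a `{P₃, P₄, P₅}`-factor: a spanning subgraph each of whose components is a
path on 3, 4, or 5 vertices. -/
def HasPPPFactor {W : Type*} (H : SimpleGraph W) : Prop :=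
  ∃ F : SimpleGraph W, F ≤ H ∧ ∀ c : F.ConnectedComponent,
    IsPathOn (F.induce c.supp) 3 ∨ IsPathOn (F.induce c.supp) 4 ∨ IsPathOn (F.induce c.supp) 5

set_option linter.unusedSectionVars false

namespace SunFactor

open Finset

variable {V : Type*} [DecidableEq V]

/-- `G` has no cut splitting the vertex set `C`. -/
def Conn (G : SimpleGraph V) (C : Finset V) : Prop :=
  ∀ X ⊆ C, X.Nonempty → (∀ x ∈ X, ∀ y ∈ C, G.Adj x y → y ∈ X) → X = C

/-- `C` is the vertex set of a connected component of `G[B]`. -/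
structure IsComp (G : SimpleGraph V) (B C : Finset V) : Prop where
  subset : C ⊆ B
  nonempty : C.Nonempty
  conn : Conn G C
  closed : ∀ x ∈ C, ∀ y ∈ B, G.Adj x y → y ∈ C

/-- `y` is a vertex of degree one in `G[C]` with neighbour `r`. -/
def Tip (G : SimpleGraph V) (C : Finset V) (r y : V) : Prop :=
  G.Adj r y ∧ ∀ x ∈ C, G.Adj y x → x = r

/-- `G[B]` has a perfect matching. -/
inductive PM (G : SimpleGraph V) : Finset V → Prop
  | empty : PM G ∅
  | pair {a b : V} {B : Finset V} (h : G.Adj a b) (ha : a ∉ B) (hb : b ∉ B) :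
      PM G B → PM G (insert a (insert b B))

/-- `G[C]` is a sun; in the second case, `R` is its core. -/
def SunOn (G : SimpleGraph V) (C : Finset V) : Prop :=
  (∃ x, C = {x}) ∨ ∃ R ⊆ C,
    (∀ r ∈ R, ∃ y ∈ C \ R, Tip G C r y ∧ ∀ y' ∈ C \ R, G.Adj r y' → y' = y) ∧
    (∀ y ∈ C \ R, ∃ r ∈ R, Tip G C r y) ∧
    ∀ r ∈ R, PM G (R.erase r)

/-- `G[B]` has a spanning system of disjoint paths, each with at least three vertices. -/
inductive Cov (G : SimpleGraph V) : Finset V → Prop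
  | empty : Cov G ∅
  | path {l : List V} {B : Finset V} (hc : l.IsChain G.Adj) (hn : l.Nodup) (h3 : 3 ≤ l.length)
      (hd : ∀ x ∈ l, x ∉ B) : Cov G B → Cov G (l.toFinset ∪ B)

open Classical in
/-- The vertex sets of the components of `G[B]` that are suns. -/
noncomputable def suns (G : SimpleGraph V) (B : Finset V) : Finset (Finset V) :=
  B.powerset.filter fun C => IsComp G B C ∧ SunOn G C

/-- `G[C]` is spanned by a path starting at `v` and a system of disjoint paths, each with at
least three vertices. -/
def Root (G : SimpleGraph V) (C : Finset V) (v : V) : Prop :=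
  ∃ t : List V, (v :: t).IsChain G.Adj ∧ (v :: t).Nodup ∧ (v :: t).toFinset ⊆ C ∧
    Cov G (C \ (v :: t).toFinset)

variable {G : SimpleGraph V} {A B C D S T : Finset V}

lemma mem_suns : C ∈ suns G B ↔ IsComp G B C ∧ SunOn G C := by
  simp only [suns, mem_filter, mem_powerset, and_iff_right_iff_imp]
  exact fun h => h.1.subset

/-! ### Components -/

lemma IsComp.subset_of_closed (h : IsComp G B C) (hD : ∀ x ∈ D, ∀ y ∈ C, G.Adj x y → y ∈ D)
    (hne : ∃ x ∈ C, x ∈ D) : C ⊆ D := by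
  obtain ⟨x, hx, hx'⟩ := hne
  have := h.conn (C ∩ D) inter_subset_left ⟨x, by simp [hx, hx']⟩ (by
    intro a ha b hb hab
    simp only [mem_inter] at ha ⊢
    exact ⟨hb, hD a ha.2 b hb hab⟩)
  rw [← this]
  exact inter_subset_right

lemma IsComp.eq_of_mem {x : V} (h : IsComp G B C) (h' : IsComp G B D) (hx : x ∈ C)
    (hx' : x ∈ D) : C = D :=
  subset_antisymm
    (h.subset_of_closed (fun a ha b hb => h'.closed a ha b (h.subset hb)) ⟨x, hx, hx'⟩)
    (h'.subset_of_closed (fun a ha b hb => h.closed a ha b (h'.subset hb)) ⟨x, hx', hx⟩)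

lemma IsComp.disjoint (h : IsComp G B C) (h' : IsComp G B D) (hne : C ≠ D) : Disjoint C D :=
  disjoint_left.2 fun _ hx hx' => hne (h.eq_of_mem h' hx hx')

lemma exists_isComp {x : V} (hx : x ∈ B) : ∃ C, IsComp G B C ∧ x ∈ C := by
  obtain ⟨C, hC, hmin⟩ := exists_min_image
    (by classical exact B.powerset.filter fun C => x ∈ C ∧ ∀ a ∈ C, ∀ y ∈ B, G.Adj a y → y ∈ C)
    card ⟨B, by simp +contextual [hx]⟩
  simp only [mem_filter, mem_powerset] at hC hmin
  obtain ⟨hCB, hxC, hcl⟩ := hC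
  refine ⟨C, ⟨hCB, ⟨x, hxC⟩, ?_, hcl⟩, hxC⟩
  intro X hXC hX hXcl
  by_cases hxX : x ∈ X
  · refine eq_of_subset_of_card_le hXC (hmin X ⟨hXC.trans hCB, hxX, fun a ha y hy hay => ?_⟩)
    exact hXcl a ha y (hcl a (hXC ha) y hy hay) hay
  · have := hmin (C \ X) ⟨sdiff_subset.trans hCB, by simp [hxC, hxX], fun a ha y hy hay => by
      simp only [mem_sdiff] at ha ⊢
      exact ⟨hcl a ha.1 y hy hay, fun h => ha.2 (hXcl y h a ha.1 hay.symm)⟩⟩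
    have h1 := card_sdiff_add_card_eq_card hXC
    have := hX.card_pos
    omega

lemma IsComp.of_closed (h : IsComp G B C) (hBD : B ⊆ D)
    (hcl : ∀ x ∈ C, ∀ y ∈ D, G.Adj x y → y ∈ B) : IsComp G D C :=
  ⟨h.subset.trans hBD, h.nonempty, h.conn,
    fun x hx y hy hxy => h.closed x hx y (hcl x hx y hy hxy) hxy⟩

lemma IsComp.mono (h : IsComp G B C) (hCD : C ⊆ D) (hDB : D ⊆ B) : IsComp G D C :=
  ⟨hCD, h.nonempty, h.conn, fun x hx y hy hxy => h.closed x hx y (hDB hy) hxy⟩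

lemma card_suns_add_le (hC : IsComp G B C) (hns : ¬ SunOn G C) (hT : T ⊆ C) :
    (suns G B).card + (suns G (C \ T)).card ≤ (suns G (B \ T)).card := by
  have hdisj : ∀ E ∈ suns G B, Disjoint E C := fun E hE =>
    (mem_suns.1 hE).1.disjoint hC (by rintro rfl; exact hns (mem_suns.1 hE).2)
  rw [← card_union_of_disjoint]
  · refine card_le_card (union_subset ?_ ?_)
    · intro E hE
      refine mem_suns.2 ⟨(mem_suns.1 hE).1.mono ?_ sdiff_subset, (mem_suns.1 hE).2⟩
      exact subset_sdiff.2 ⟨(mem_suns.1 hE).1.subset, (hdisj E hE).mono_right hT⟩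
    · intro E hE
      refine mem_suns.2 ⟨(mem_suns.1 hE).1.of_closed (sdiff_subset_sdiff hC.subset le_rfl) ?_,
        (mem_suns.1 hE).2⟩
      intro x hx y hy hxy
      have hx' := (mem_suns.1 hE).1.subset hx
      simp only [mem_sdiff] at hx' hy ⊢
      exact ⟨hC.closed x hx'.1 y hy.1 hxy, hy.2⟩
  · refine disjoint_left.2 fun E hE hE' => ?_
    obtain ⟨x, hx⟩ := (mem_suns.1 hE).1.nonempty
    exact disjoint_left.1 (hdisj E hE) hx (mem_sdiff.1 ((mem_suns.1 hE').1.subset hx)).1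

lemma card_suns_sdiff_succ_le (hC : C ∈ suns G B) (hT : T ⊆ B \ C) :
    (suns G ((B \ C) \ T)).card + 1 ≤ (suns G (B \ T)).card := by
  have hC' := mem_suns.1 hC
  rw [← card_insert_of_notMem (a := C)]
  · refine card_le_card (insert_subset ?_ ?_)
    · refine mem_suns.2 ⟨hC'.1.mono ?_ sdiff_subset, hC'.2⟩
      refine subset_sdiff.2 ⟨hC'.1.subset, ?_⟩
      exact disjoint_left.2 fun x hx hxT => (mem_sdiff.1 (hT hxT)).2 hx
    · intro E hE
      refine mem_suns.2 ⟨(mem_suns.1 hE).1.of_closed (sdiff_subset_sdiff sdiff_subset le_rfl) ?_,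
        (mem_suns.1 hE).2⟩
      intro x hx y hy hxy
      have hx' := (mem_suns.1 hE).1.subset hx
      simp only [mem_sdiff] at hx' hy ⊢
      exact ⟨⟨hy.1, fun h => hx'.1.2 (hC'.1.closed y h x hx'.1.1 hxy.symm)⟩, hy.2⟩
  · intro h
    obtain ⟨x, hx⟩ := hC'.1.nonempty
    have := (mem_suns.1 h).1.subset hx
    simp [hx] at this

/-! ### Path systems and matchings -/

lemma Cov.union (hA : Cov G A) (hB : Cov G B) (h : Disjoint A B) : Cov G (A ∪ B) := by
  induction hA with
  | empty => simpa
  | @path l A' hc hn h3 hd _ ih =>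
    rw [union_assoc]
    rw [disjoint_union_left] at h
    refine .path hc hn h3 (fun x hx => ?_) (ih h.2)
    simp only [mem_union, not_or]
    exact ⟨hd x hx, disjoint_left.1 h.1 (by simpa using hx)⟩

lemma Cov.mono {G' : SimpleGraph V} (hG : G ≤ G') (h : Cov G A) : Cov G' A := by
  induction h with
  | empty => exact .empty
  | path hc hn h3 hd _ ih => exact .path (hc.imp fun _ _ h => hG h) hn h3 hd ih

lemma Cov.biUnion {ι : Type*} [DecidableEq ι] {s : Finset ι} {P : ι → Finset V}
    (h : ∀ i ∈ s, Cov G (P i)) (hd : (s : Set ι).PairwiseDisjoint P) : Cov G (s.biUnion P) := by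
  induction s using Finset.induction_on with
  | empty => exact .empty
  | insert a s ha ih =>
    rw [biUnion_insert]
    refine (h a (by simp)).union (ih (fun i hi => h i (by simp [hi]))
      (hd.subset (by simp))) ?_
    rw [disjoint_biUnion_right]
    exact fun i hi => hd (by simp) (by simp [hi]) (by rintro rfl; exact ha hi)

lemma cov_of_isComp (h : ∀ C, IsComp G B C → Cov G C) : Cov G B := by
  induction B using Finset.strongInduction with
  | H B ih =>
    rcases B.eq_empty_or_nonempty with rfl | ⟨x, hx⟩
    · exact .empty
    obtain ⟨C, hC, hxC⟩ := exists_isComp (G := G) hx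
    rw [← union_sdiff_of_subset hC.subset]
    refine (h C hC).union (ih _ (sdiff_ssubset hC.subset hC.nonempty) fun D hD => h D ?_)
      disjoint_sdiff
    refine hD.of_closed sdiff_subset fun x hx y hy hxy => ?_
    have hx' := mem_sdiff.1 (hD.subset hx)
    exact mem_sdiff.2 ⟨hy, fun h => hx'.2 (hC.closed y h x hx'.1 hxy.symm)⟩

lemma exists_adj_of_isChain {a y : V} {l : List V} (hc : (a :: l).IsChain G.Adj) (hy : y ∈ l) :
    ∃ x ∈ a :: l, G.Adj x y := by
  induction l generalizing a with
  | nil => simp at hy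
  | cons b l ih =>
    rw [List.isChain_cons_cons] at hc
    rcases List.mem_cons.1 hy with rfl | hy
    · exact ⟨a, by simp, hc.1⟩
    · obtain ⟨x, hx, h⟩ := ih hc.2 hy
      exact ⟨x, List.mem_cons_of_mem _ hx, h⟩

lemma exists_adj_of_isChain_of_two_le {y : V} {l : List V} (hc : l.IsChain G.Adj)
    (h2 : 2 ≤ l.length) (hy : y ∈ l) : ∃ x ∈ l, G.Adj y x := by
  match l, h2 with
  | a :: b :: l, _ =>
    rcases List.mem_cons.1 hy with rfl | hy
    · exact ⟨b, by simp, (List.isChain_cons_cons.1 hc).1⟩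
    · obtain ⟨x, hx, h⟩ := exists_adj_of_isChain hc hy
      exact ⟨x, hx, h.symm⟩

lemma Cov.exists_adj {y : V} (h : Cov G B) (hy : y ∈ B) : ∃ x ∈ B, G.Adj y x := by
  induction h with
  | empty => simp at hy
  | path hc hn h3 hd _ ih =>
    rcases mem_union.1 hy with hy | hy
    · obtain ⟨x, hx, h⟩ := exists_adj_of_isChain_of_two_le hc (by omega) (List.mem_toFinset.1 hy)
      exact ⟨x, by simp [hx], h⟩
    · obtain ⟨x, hx, h⟩ := ih hy
      exact ⟨x, by simp [hx], h⟩

lemma PM.exists_partner {a : V} (h : PM G B) (ha : a ∈ B) :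
    ∃ b ∈ B, G.Adj a b ∧ PM G ((B.erase a).erase b) := by
  induction h with
  | empty => simp at ha
  | @pair c d B hcd hc hd hB ih =>
    have hne := hcd.ne
    rcases mem_insert.1 ha with rfl | ha
    · refine ⟨d, by simp, hcd, ?_⟩
      convert hB using 1
      grind
    rcases mem_insert.1 ha with rfl | ha
    · refine ⟨c, by simp, hcd.symm, ?_⟩
      convert hB using 1
      grind
    obtain ⟨b, hb, hab, h⟩ := ih ha
    refine ⟨b, by simp [hb], hab, ?_⟩
    have := PM.pair hcd (B := (B.erase a).erase b) (by simp [hc]) (by simp [hd]) h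
    convert this using 1
    grind

lemma PM.cov {w : V → V} (h : PM G B) (hw : ∀ r ∈ B, G.Adj r (w r))
    (hinj : Set.InjOn w B) (hd : ∀ r ∈ B, w r ∉ B) : Cov G (B ∪ B.image w) := by
  induction h with
  | empty => exact .empty
  | @pair a b B hab ha hb hB ih =>
    have hne := hab.ne
    have ih := ih (fun r hr => hw r (by simp [hr])) (hinj.mono (by simp [Set.subset_def]; tauto))
      (fun r hr h => hd r (by simp [hr]) (by simp [h]))
    have hda := hd a (by simp)
    have hdb := hd b (by simp)
    have hwab : w a ≠ w b := fun h => hne (hinj (by simp) (by simp) h)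
    have h1 : ∀ r ∈ B, w r ≠ w a := fun r hr h =>
      ha (hinj (by simp [hr]) (by simp) h ▸ hr)
    have h2 : ∀ r ∈ B, w r ≠ w b := fun r hr h =>
      hb (hinj (by simp [hr]) (by simp) h ▸ hr)
    have h3 : ∀ r ∈ B, w r ≠ a ∧ w r ≠ b := fun r hr => by
      have := hd r (by simp [hr]); simp at this; tauto
    have := Cov.path (l := [w a, a, b, w b]) (B := B ∪ B.image w) (G := G)
      (by simp [hab, (hw a (by simp)).symm, hw b (by simp)]) (by simp at hda hdb ⊢; grind) (by simp)
      (by simp at hda hdb ⊢; grind) ih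
    convert this using 1
    ext x
    simp
    grind

/-! ### Structure of suns -/

/-- `G[C]` is a sun with core `R`, the tip attached to `r ∈ R` being `w r`. -/
structure IsCore (G : SimpleGraph V) (C R : Finset V) (w : V → V) : Prop where
  eq : C = R ∪ R.image w
  inj : Set.InjOn w R
  notMem : ∀ r ∈ R, w r ∉ R
  adj : ∀ r ∈ R, G.Adj r (w r)
  tip : ∀ r ∈ R, ∀ x ∈ C, G.Adj (w r) x → x = r
  pm : ∀ r ∈ R, PM G (R.erase r)

lemma SunOn.exists_isCore (h : SunOn G C) : (∃ x, C = {x}) ∨ ∃ R w, IsCore G C R w := by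
  rcases h with h | ⟨R, hR, h1, h2, h3⟩
  · exact .inl h
  right
  choose! w hw hw' hu using h1
  refine ⟨R, w, ?_, ?_, fun r hr => (mem_sdiff.1 (hw r hr)).2, fun r hr => (hw' r hr).1,
    fun r hr => (hw' r hr).2, h3⟩
  · ext x
    simp only [mem_union, mem_image]
    constructor
    · intro hx
      by_cases hxR : x ∈ R
      · exact .inl hxR
      · obtain ⟨r, hr, ht⟩ := h2 x (by simp [hx, hxR])
        exact .inr ⟨r, hr, (hu r hr x (by simp [hx, hxR]) ht.1).symm⟩
    · rintro (hx | ⟨r, hr, rfl⟩)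
      · exact hR hx
      · exact (mem_sdiff.1 (hw r hr)).1
  · intro a ha b hb hab
    exact (hw' b hb).2 a (hR ha) (hab ▸ (hw' a ha).1.symm)

lemma IsCore.sunOn {R : Finset V} {w : V → V} (h : IsCore G C R w) : SunOn G C := by
  have hC := h.eq
  have hwC : ∀ r ∈ R, w r ∈ C := fun r hr => by
    rw [hC]; exact mem_union_right _ (mem_image_of_mem _ hr)
  have key : ∀ y ∈ C \ R, ∃ r ∈ R, w r = y := by
    intro y hy
    rw [hC] at hy
    simp only [mem_sdiff, mem_union, mem_image] at hy
    tauto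
  refine .inr ⟨R, by rw [hC]; exact subset_union_left, ?_, ?_, h.pm⟩
  · refine fun r hr => ⟨w r, mem_sdiff.2 ⟨hwC r hr, h.notMem r hr⟩, ⟨h.adj r hr, h.tip r hr⟩, ?_⟩
    intro y hy hry
    obtain ⟨r', hr', rfl⟩ := key y hy
    rw [h.tip r' hr' r (by rw [hC]; exact mem_union_left _ hr) hry.symm]
  · intro y hy
    obtain ⟨r, hr, rfl⟩ := key y hy
    exact ⟨r, hr, h.adj r hr, h.tip r hr⟩

lemma IsCore.cov {R X : Finset V} {w : V → V} (h : IsCore G C R w) (hX : X ⊆ R) (hpm : PM G X) :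
    Cov G (X ∪ X.image w) :=
  hpm.cov (fun r hr => h.adj r (hX hr)) (h.inj.mono hX) fun r hr hr' => h.notMem r (hX hr) (hX hr')

lemma IsCore.cov_sdiff {R X Y : Finset V} {w : V → V} (h : IsCore G C R w) (hX : X ⊆ R)
    (hpm : PM G (R \ X)) (hY : Y = X ∪ X.image w) : Cov G (C \ Y) := by
  convert h.cov sdiff_subset hpm using 1
  subst hY
  have := h.eq
  have := h.notMem
  have := h.inj
  ext x
  simp only [h.eq, mem_sdiff, mem_union, mem_image, Set.InjOn, mem_coe] at *
  grind

lemma SunOn.eq_singleton_or (h : SunOn G C) {v : V} (hv : v ∈ C) :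
    C = {v} ∨ ∃ u ∈ C, G.Adj v u ∧ Cov G (C \ {v, u}) := by
  rcases h.exists_isCore with ⟨x, rfl⟩ | ⟨R, w, h⟩
  · left; simp at hv; rw [hv]
  right
  rw [h.eq] at hv
  have hwC : ∀ r ∈ R, w r ∈ C := fun r hr => by
    rw [h.eq]; exact mem_union_right _ (mem_image_of_mem _ hr)
  have hRC : R ⊆ C := by rw [h.eq]; exact subset_union_left
  rcases mem_union.1 hv with hv | hv
  · refine ⟨w v, hwC v hv, h.adj v hv, ?_⟩
    refine h.cov_sdiff (X := {v}) (by simpa)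
      (by simpa [sdiff_singleton_eq_erase] using h.pm v hv) ?_
    rfl
  · obtain ⟨r, hr, rfl⟩ := mem_image.1 hv
    refine ⟨r, hRC hr, (h.adj r hr).symm, ?_⟩
    refine h.cov_sdiff (X := {r}) (by simpa)
      (by simpa [sdiff_singleton_eq_erase] using h.pm r hr) ?_
    simp; exact pair_comm _ _

lemma SunOn.root (h : SunOn G C) {v : V} (hv : v ∈ C) : Root G C v := by
  rcases h.eq_singleton_or hv with rfl | ⟨u, hu, hvu, hc⟩
  · exact ⟨[], by simp, by simp, by simp, by simpa using Cov.empty⟩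
  · exact ⟨[u], by simpa, by simpa using hvu.ne, by simp [insert_subset_iff, hv, hu], by simpa⟩

lemma Cov.of_sdiff {l : List V} (hc : l.IsChain G.Adj) (hn : l.Nodup) (h3 : 3 ≤ l.length)
    (hl : l.toFinset ⊆ C) (h : Cov G (C \ l.toFinset)) : Cov G C := by
  rw [← union_sdiff_of_subset hl]
  exact .path hc hn h3 (by simp +contextual) h

lemma SunOn.cov_insert (h : SunOn G C) {v b : V} (hv : v ∈ C) (hb : b ∉ C) (hbv : G.Adj b v)
    (hne : C ≠ {v}) : Cov G (insert b C) := by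
  obtain ⟨u, hu, hvu, hc⟩ := (h.eq_singleton_or hv).resolve_left hne
  refine Cov.of_sdiff (l := [b, v, u]) (by simp [hbv, hvu]) ?_ (by simp) ?_ ?_
  · simp [hbv.ne, hvu.ne]; rintro rfl; exact hb hu
  · simp [insert_subset_iff, hv, hu]
  · convert hc using 1
    ext x; simp; grind

lemma Root.cov_join {s u v : V} (hC : Root G C u) (hD : Root G D v) (hCD : Disjoint C D)
    (hsC : s ∉ C) (hsD : s ∉ D) (hu : G.Adj s u) (hv : G.Adj s v) :
    Cov G (insert s (C ∪ D)) := by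
  obtain ⟨t, ht, htn, htC, htc⟩ := hC
  obtain ⟨t', ht', htn', htC', htc'⟩ := hD
  have key := disjoint_left.1 hCD
  have h1 : ∀ x ∈ u :: t, x ∈ C := fun x hx => htC (List.mem_toFinset.2 hx)
  have h2 : ∀ x ∈ v :: t', x ∈ D := fun x hx => htC' (List.mem_toFinset.2 hx)
  generalize hl : u :: t = l at *
  generalize hl' : v :: t' = l' at *
  refine Cov.of_sdiff (l := l.reverse ++ s :: l') ?_ ?_ ?_ ?_ ?_
  · rw [List.isChain_append]
    refine ⟨by rw [List.isChain_reverse]; exact ht.imp fun _ _ h => h.symm, ?_, ?_⟩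
    · rw [← hl', List.isChain_cons_cons, hl']; exact ⟨hv, ht'⟩
    · simp [← hl, hu.symm]
  · rw [List.nodup_append, List.nodup_cons]
    refine ⟨by simpa, ⟨fun h => hsD (h2 s h), htn'⟩, ?_⟩
    simp only [List.mem_reverse, List.mem_cons]
    rintro a ha b (rfl | hb) rfl
    · exact hsC (h1 _ ha)
    · exact key (h1 _ ha) (h2 _ hb)
  · simp [← hl, ← hl']; omega
  · intro x hx
    simp at hx
    simp
    grind
  · convert htc.union htc' (hCD.mono sdiff_subset sdiff_subset) using 1
    ext x
    simp
    grind

/-- `G[C]` is spanned by a system of disjoint paths in which either some path joins `z` to `u`, or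
distinct paths with at least two vertices start at `z` and at `u`, and all other paths have at least
three vertices. -/
def TwoRoot (G : SimpleGraph V) (C : Finset V) (z u : V) : Prop :=
  (∃ l : List V, l.IsChain G.Adj ∧ l.Nodup ∧ l.head? = some z ∧ l.getLast? = some u ∧
    l.toFinset ⊆ C ∧ Cov G (C \ l.toFinset)) ∨
  ∃ t t' : List V, (z :: t).IsChain G.Adj ∧ (u :: t').IsChain G.Adj ∧
    (z :: t ++ u :: t').Nodup ∧ t ≠ [] ∧ t' ≠ [] ∧ (z :: t ++ u :: t').toFinset ⊆ C ∧
    Cov G (C \ (z :: t ++ u :: t').toFinset)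

lemma SunOn.twoRoot (h : SunOn G C) {z : V} (hz : z ∈ C) :
    (∀ u ∈ C, TwoRoot G C z u) ∨ ∃ y ∈ C, Tip G C z y ∧ TwoRoot G C z y := by
  rcases h.exists_isCore with ⟨x, rfl⟩ | ⟨R, w, h⟩
  · left
    simp only [mem_singleton] at hz
    subst hz
    simp only [mem_singleton, forall_eq]
    exact .inl ⟨[z], by simp, by simp, by simp, by simp, by simp, by simpa using Cov.empty⟩
  have hwC : ∀ r ∈ R, w r ∈ C := fun r hr => by
    rw [h.eq]; exact mem_union_right _ (mem_image_of_mem _ hr)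
  have hRC : R ⊆ C := by rw [h.eq]; exact subset_union_left
  have hmem : ∀ u ∈ C, ∃ r ∈ R, u = r ∨ u = w r := by
    intro u hu
    rw [h.eq] at hu
    rcases mem_union.1 hu with hu | hu
    · exact ⟨u, hu, .inl rfl⟩
    · obtain ⟨r, hr, rfl⟩ := mem_image.1 hu
      exact ⟨r, hr, .inr rfl⟩
  have hpm1 : ∀ r ∈ R, Cov G (C \ {r, w r}) := fun r hr =>
    h.cov_sdiff (X := {r}) (by simpa) (by simpa [sdiff_singleton_eq_erase] using h.pm r hr)
      rfl
  have hne : ∀ r ∈ R, ∀ r' ∈ R, w r ≠ r' := fun r hr r' hr' e => h.notMem r hr (e ▸ hr')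
  have hinj : ∀ r ∈ R, ∀ r' ∈ R, w r = w r' → r = r' := fun r hr r' hr' e => h.inj hr hr' e
  obtain ⟨r, hr, rfl | rfl⟩ := hmem z hz
  · right
    refine ⟨w z, hwC z hr, ⟨h.adj z hr, h.tip z hr⟩, .inl ⟨[z, w z], ?_⟩⟩
    have := h.adj z hr
    refine ⟨by simpa, by simpa using this.ne, by simp, by simp, ?_, by simpa using hpm1 z hr⟩
    simp [insert_subset_iff, hwC z hr, hRC hr]
  by_cases hR : R = {r}
  · right
    refine ⟨r, hRC hr, ⟨(h.adj r hr).symm, ?_⟩, .inl ⟨[w r, r], ?_⟩⟩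
    · intro x hx hrx
      obtain ⟨r', hr', rfl | rfl⟩ := hmem x hx
      · rw [hR, mem_singleton] at hr'
        exact absurd hrx (by rw [hr']; exact G.irrefl)
      · rw [hR, mem_singleton] at hr'
        rw [hr']
    · have := (h.adj r hr).symm
      have h' := hpm1 r hr
      rw [pair_comm] at h'
      refine ⟨by simpa, by simpa using this.ne, by simp, by simp, ?_, by simpa⟩
      simp [insert_subset_iff, hwC r hr, hRC hr]
  left
  -- removing a core vertex `q ≠ r` and the pair containing `r` in the resulting matching
  have hpm2 : ∀ q ∈ R, q ≠ r → ∃ x ∈ R, x ≠ r ∧ x ≠ q ∧ G.Adj r x ∧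
      Cov G (C \ ({q, r, x} ∪ {w q, w r, w x})) := by
    intro q hq hqr
    obtain ⟨x, hx, hrx, hpm⟩ := (h.pm q hq).exists_partner (a := r) (by simp [hqr.symm, hr])
    simp only [mem_erase] at hx
    refine ⟨x, hx.2, hrx.ne.symm, hx.1, hrx, ?_⟩
    refine h.cov_sdiff (X := {q, r, x}) (by simp [insert_subset_iff, hq, hr, hx.2]) ?_ ?_
    · convert hpm using 1
      ext y; simp; tauto
    · simp [image_insert]
  have pathQ : ∀ q ∈ R, q ≠ r → ∀ u u', (u = q ∧ u' = w q ∨ u = w q ∧ u' = q) →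
      TwoRoot G C (w r) u := by
    intro q hq hqr u u' huu
    obtain ⟨x, hx, hxr, hxq, hrx, hc⟩ := hpm2 q hq hqr
    have hq' := h.adj q hq
    refine .inr ⟨[r, x, w x], [u'], ?_, ?_, ?_, by simp, by simp, ?_, ?_⟩
    · simp [hrx, h.adj x hx, (h.adj r hr).symm]
    · rcases huu with ⟨rfl, rfl⟩ | ⟨rfl, rfl⟩ <;> simp [hq', hq'.symm]
    · rcases huu with ⟨rfl, rfl⟩ | ⟨rfl, rfl⟩ <;> simp <;> grind
    · have h1 := hRC hq
      have h2 := hwC q hq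
      rcases huu with ⟨rfl, rfl⟩ | ⟨rfl, rfl⟩ <;>
        simp [insert_subset_iff, hRC hr, hwC r hr, h1, h2, hRC hx, hwC x hx]
    · convert hc using 2
      rcases huu with ⟨rfl, rfl⟩ | ⟨rfl, rfl⟩ <;> ext y <;> simp <;> tauto
  intro u hu
  obtain ⟨q, hq, hqu⟩ := hmem u hu
  by_cases hqr : q = r
  · subst hqr
    rcases hqu with rfl | rfl
    · refine .inl ⟨[w u, u], ?_⟩
      have := (h.adj u hr).symm
      have h' := hpm1 u hr
      rw [pair_comm] at h'
      refine ⟨by simpa, by simpa using this.ne, by simp, by simp, ?_, by simpa⟩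
      simp [insert_subset_iff, hwC u hr, hRC hr]
    · -- the core has a further vertex, so `q` is the middle of a path through two core edges
      obtain ⟨q', hq', hqq'⟩ : ∃ q' ∈ R, q' ≠ q := by
        by_contra! hcon
        exact hR (eq_singleton_iff_unique_mem.2 ⟨hq, hcon⟩)
      obtain ⟨x, hx, hxr, hxq, hrx, -⟩ := hpm2 q' hq' hqq'
      obtain ⟨y, hy, hyr, hyx, hry, hc⟩ := hpm2 x hx hxr
      refine .inl ⟨[w q], by simp, by simp, by simp, by simp, by simp [hwC q hq], ?_⟩
      refine Cov.of_sdiff (l := [w x, x, q, y, w y]) ?_ ?_ (by simp) ?_ ?_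
      · simp [hrx.symm, hry, h.adj y hy, (h.adj x hx).symm]
      · simp; grind
      · simp [insert_subset_iff, hRC hq, hRC hx, hwC x hx, hRC hy, hwC y hy]
        grind
      · convert hc using 1
        ext a; simp; tauto
  · rcases hqu with rfl | rfl
    · exact pathQ u hq hqr _ _ (.inl ⟨rfl, rfl⟩)
    · exact pathQ q hq hqr _ _ (.inr ⟨rfl, rfl⟩)

lemma TwoRoot.root_union {u v z : V} (hC : TwoRoot G C z u) (hD : Root G D v)
    (hCD : Disjoint C D) (hvz : G.Adj v z) : Root G (C ∪ D) u := by
  obtain ⟨t', ht', htn', htC', htc'⟩ := hD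
  have key := disjoint_left.1 hCD
  have h2 : ∀ x ∈ v :: t', x ∈ D := fun x hx => htC' (List.mem_toFinset.2 hx)
  generalize hl' : v :: t' = l' at *
  rcases hC with ⟨l, hc, hn, hh, hlast, hlC, hcov⟩ | ⟨t, s, hzc, huc, hn, ht, hs, hsub, hcov⟩
  · have h1 : ∀ x ∈ l, x ∈ C := fun x hx => hlC (List.mem_toFinset.2 hx)
    obtain ⟨m, hm⟩ : ∃ m, l.reverse = u :: m := by
      rw [← List.head?_reverse] at hlast
      cases hr : l.reverse with
      | nil => simp [hr] at hlast
      | cons a m => simp [hr] at hlast; exact ⟨m, by rw [hlast]⟩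
    refine ⟨m ++ l', ?_⟩
    rw [← List.cons_append, ← hm]
    refine ⟨?_, ?_, ?_, ?_⟩
    · rw [List.isChain_append]
      refine ⟨by rw [List.isChain_reverse]; exact hc.imp fun _ _ h => h.symm, ht', ?_⟩
      simp [hh, ← hl', hvz.symm]
    · rw [List.nodup_append]
      refine ⟨by simpa, htn', ?_⟩
      rintro a ha b hb rfl
      exact key (h1 _ (by simpa using ha)) (h2 _ hb)
    · intro x hx
      simp at hx
      simp
      grind
    · convert hcov.union htc' (hCD.mono sdiff_subset sdiff_subset) using 1
      ext x
      simp
      grind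
  · have h1 : ∀ x ∈ z :: t ++ u :: s, x ∈ C := fun x hx => hsub (List.mem_toFinset.2 hx)
    rw [List.nodup_append] at hn
    obtain ⟨hn1, hn2, hn3⟩ := hn
    generalize hk : z :: t = k at *
    generalize hj : u :: s = j at *
    refine ⟨s, ?_⟩
    rw [hj]
    refine ⟨huc, hn2, ?_, ?_⟩
    · intro x hx
      simp at hx
      simp
      left; exact h1 x (by simp [hx])
    · refine Cov.of_sdiff (l := k.reverse ++ l') ?_ ?_ ?_ ?_ ?_
      · rw [List.isChain_append]
        refine ⟨by rw [List.isChain_reverse]; exact hzc.imp fun _ _ h => h.symm, ht', ?_⟩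
        simp [← hk, ← hl', hvz.symm]
      · rw [List.nodup_append]
        refine ⟨by simpa, htn', ?_⟩
        rintro a ha b hb rfl
        exact key (h1 _ (by simp at ha; simp [ha])) (h2 _ hb)
      · have := List.length_pos_iff.2 ht
        simp [← hk, ← hl']; omega
      · intro x hx
        simp at hx
        simp
        grind
      · convert hcov.union htc' (hCD.mono sdiff_subset sdiff_subset) using 1
        ext x
        simp
        grind

/-- Adding an edge joining two distinct nonadjacent roots. -/
lemma TwoRoot.cov_of_adj {G' : SimpleGraph V} {u z : V} (hC : TwoRoot G C z u) (hG : G ≤ G')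
    (hne : z ≠ u) (hzu : ¬ G.Adj z u) (hadj : G'.Adj z u) : Cov G' C := by
  rcases hC with ⟨l, hc, hn, hh, hlast, hlC, hcov⟩ | ⟨t, s, hzc, huc, hn, ht, hs, hsub, hcov⟩
  · refine Cov.mono hG (Cov.of_sdiff hc hn ?_ hlC hcov)
    match l with
    | [] => simp at hh
    | [a] => simp at hh hlast; exact absurd (hh.symm.trans hlast) hne
    | [a, b] =>
      simp at hh hlast hc
      subst hh hlast
      exact absurd hc hzu
    | a :: b :: c :: l => simp
  · have hne' := hn
    rw [List.nodup_append] at hn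
    obtain ⟨hn1, hn2, hn3⟩ := hn
    generalize hk : z :: t = k at *
    generalize hj : u :: s = j at *
    refine Cov.of_sdiff (l := k.reverse ++ j) ?_ ?_ ?_ ?_ ?_
    · rw [List.isChain_append]
      refine ⟨by rw [List.isChain_reverse]; exact hzc.imp fun _ _ h => (hG h).symm,
        huc.imp fun _ _ h => hG h, ?_⟩
      simp [← hk, ← hj, hadj]
    · rw [List.nodup_append]
      exact ⟨by simpa, hn2, fun a ha b hb => hn3 a (by simpa using ha) b hb⟩
    · have := List.length_pos_iff.2 ht
      simp [← hk, ← hj]; omega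
    · intro x hx
      exact hsub (by simpa using hx)
    · convert hcov.mono hG using 2
      ext x
      simp

/-- A path system covering a set of vertices together with their tips yields a perfect matching. -/
lemma Cov.pm_of_tips {X : Finset V} {w : V → V} (h : Cov G B) (hB : B = X ∪ X.image w)
    (hd : ∀ r ∈ X, w r ∉ X) (htip : ∀ r ∈ X, ∀ x ∈ B, G.Adj (w r) x → x = r) :
    PM G X := by
  induction h generalizing X with
  | empty =>
    have : X = ∅ := by
      rw [eq_empty_iff_forall_notMem]
      intro x hx
      have := mem_union_left (X.image w) hx
      rw [← hB] at this
      simp at this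
    rw [this]; exact .empty
  | @path l B hc hn h3 hdis hcov ih =>
    have hwx : ∀ r ∈ X, r ∈ l ↔ w r ∈ l := by
      intro r hr
      have hrB : r ∈ l.toFinset ∪ B := by rw [hB]; exact mem_union_left _ hr
      have hwB : w r ∈ l.toFinset ∪ B := by
        rw [hB]; exact mem_union_right _ (mem_image_of_mem _ hr)
      constructor
      · intro hrl
        rcases mem_union.1 hwB with h | h
        · simpa using h
        · obtain ⟨x, hx, hadj⟩ := hcov.exists_adj h
          rw [htip r hr x (mem_union_right _ hx) hadj] at hx
          exact absurd hx (hdis r hrl)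
      · intro hrl
        obtain ⟨x, hx, hadj⟩ := exists_adj_of_isChain_of_two_le hc (by omega) hrl
        rwa [htip r hr x (mem_union_left _ (by simpa)) hadj] at hx
    have hmem : ∀ a ∈ l, a ∈ X ∨ ∃ r ∈ X, w r = a := by
      intro a ha
      have : a ∈ l.toFinset ∪ B := mem_union_left _ (by simpa)
      rw [hB] at this
      simpa using this
    have htl : ∀ r ∈ X, ∀ x ∈ l, G.Adj (w r) x → x = r := fun r hr x hx =>
      htip r hr x (mem_union_left _ (by simpa))
    have hX' : PM G (X \ l.toFinset) := by
      refine ih ?_ ?_ ?_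
      · ext x
        have := hwx
        have h' := Finset.ext_iff.1 hB x
        simp only [mem_union, List.mem_toFinset, mem_image, mem_sdiff] at h' ⊢
        constructor
        · intro hx
          rcases h'.1 (.inr hx) with h | ⟨r, hr, rfl⟩
          · exact .inl ⟨h, fun hh => hdis x hh hx⟩
          · exact .inr ⟨r, ⟨hr, fun hh => hdis _ ((hwx r hr).1 hh) hx⟩, rfl⟩
        · rintro (⟨hx, hxl⟩ | ⟨r, ⟨hr, hrl⟩, rfl⟩)
          · exact (h'.2 (.inl hx)).resolve_left hxl
          · exact (h'.2 (.inr ⟨r, hr, rfl⟩)).resolve_left fun hh => hrl ((hwx r hr).2 hh)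
      · intro r hr h
        exact hd r (mem_sdiff.1 hr).1 (mem_sdiff.1 h).1
      · exact fun r hr x hx => htip r (mem_sdiff.1 hr).1 x (mem_union_right _ hx)
    match l, h3 with
    | a :: b :: c :: t, _ =>
      have hc' := hc
      have hn' := hn
      simp only [List.isChain_cons_cons] at hc
      obtain ⟨hab, hbc, hct⟩ := hc
      simp only [List.nodup_cons, List.mem_cons, not_or] at hn
      obtain ⟨⟨hab', hac', hat⟩, ⟨hbc', hbt⟩, hct', htn⟩ := hn
      have haX : a ∉ X := by
        intro haX
        have hwl : w a ∈ b :: c :: t :=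
          (List.mem_cons.1 ((hwx a haX).1 (by simp))).resolve_left fun e => hd a haX (by rwa [e])
        have hwl' : w a = b := by
          rcases List.mem_cons.1 hwl with h | h
          · exact h
          · obtain ⟨x, hx, hadj⟩ := exists_adj_of_isChain
              (List.isChain_cons_cons.2 ⟨hbc, hct⟩ : (b :: c :: t).IsChain G.Adj) h
            have := htl a haX x (List.mem_cons_of_mem _ hx) hadj.symm
            subst this
            simp only [List.mem_cons] at hx
            tauto
        exact hac' (htl a haX c (by simp) (hwl' ▸ hbc)).symm
      obtain ⟨r, hr, rfl⟩ := (hmem a (by simp)).resolve_left haX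
      have hbr := htl r hr b (by simp) hab
      subst hbr
      have hcX : c ∈ X := by
        by_contra hcX
        obtain ⟨q, hq, rfl⟩ := (hmem c (by simp)).resolve_left hcX
        rw [htl q hq b (by simp) hbc.symm] at hac'
        exact hac' rfl
      have hwt : w c ∈ t := by
        have := (hwx c hcX).1 (by simp)
        simp only [List.mem_cons] at this
        rcases this with h | h | h | h
        · exact absurd (htl b hr c (by simp) (h ▸ (by
            obtain ⟨x, hx, hadj⟩ := exists_adj_of_isChain_of_two_le hc' (by simp)
              ((hwx c hcX).1 (by simp))
            rwa [htl c hcX x hx hadj] at hadj))) fun e => hbc' e.symm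
        · exact absurd (by rwa [h]) (hd c hcX)
        · exact absurd (by rwa [h]) (hd c hcX)
        · exact h
      obtain ⟨d, t, rfl⟩ : ∃ d t', t = d :: t' := by
        cases t with
        | nil => simp at hwt
        | cons d t => exact ⟨d, t, rfl⟩
      have hdt := (List.isChain_cons_cons.1 hct).2
      have hwd : w c = d := by
        rcases List.mem_cons.1 hwt with h | h
        · exact h
        · obtain ⟨x, hx, hadj⟩ := exists_adj_of_isChain hdt h
          have := htl c hcX x (by simp at hx ⊢; tauto) hadj.symm
          subst this
          exact absurd hx hct'
      have htnil : t = [] := by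
        cases t with
        | nil => rfl
        | cons f t =>
          have := htl c hcX f (by simp) (hwd ▸ (List.isChain_cons_cons.1 hdt).1)
          subst this
          simp at hct'
      subst htnil
      have := PM.pair hbc (by simp) (by simp) hX'
      convert this using 1
      have := hd b hr
      have := hd c hcX
      ext x
      simp
      grind

/-! ### Kaneko's theorem -/

/-- The condition `sun(G[A] - S) ≤ 2|S|` for all `S ⊆ A`. -/
def Kan (G : SimpleGraph V) (A : Finset V) : Prop :=
  ∀ S ⊆ A, (suns G (A \ S)).card ≤ 2 * S.card

lemma cov_of_hall {ι : Type*} [DecidableEq ι] {X : Finset ι} {P N : ι → Finset V}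
    (hP : (X : Set ι).PairwiseDisjoint P) (hPS : ∀ i ∈ X, Disjoint (P i) S)
    (hN : ∀ i ∈ X, N i ⊆ S) (hcard : X.card = 2 * S.card)
    (hall : ∀ Y ⊆ X, Y.card ≤ 2 * (Y.biUnion N).card)
    (hroot : ∀ i ∈ X, ∀ s ∈ N i, ∃ v, G.Adj s v ∧ Root G (P i) v) :
    Cov G (S ∪ X.biUnion P) := by
  obtain ⟨f, hf, hfN⟩ := (all_card_le_biUnion_card_iff_exists_injective
    (fun i : X => N i ×ˢ (univ : Finset Bool))).1 (by
      intro s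
      have : s.biUnion (fun i : X => N i ×ˢ (univ : Finset Bool)) =
          (s.map (Function.Embedding.subtype _)).biUnion N ×ˢ univ := by
        ext x
        simp
      rw [this, card_product, card_univ, Fintype.card_bool, mul_comm,
        ← card_map (Function.Embedding.subtype _)]
      refine hall _ fun i hi => ?_
      simp at hi
      exact hi.1)
  have himg : univ.image f = S ×ˢ (univ : Finset Bool) := by
    refine eq_of_subset_of_card_le ?_ ?_
    · intro x hx
      obtain ⟨i, -, rfl⟩ := mem_image.1 hx
      have := hfN i
      simp only [mem_product, mem_univ, and_true] at this ⊢
      exact hN i i.2 this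
    · rw [card_image_of_injective _ hf, card_product, card_univ, Fintype.card_bool, card_univ,
        Fintype.card_coe, hcard, mul_comm]
  have hsurj : ∀ s ∈ S, ∀ b : Bool, ∃ i : X, f i = (s, b) := by
    intro s hs b
    have : (s, b) ∈ univ.image f := by rw [himg]; simp [hs]
    simpa using this
  rcases S.eq_empty_or_nonempty with rfl | ⟨s₀, hs₀⟩
  · have : X = ∅ := by simpa using hcard
    subst this
    exact .empty
  obtain ⟨i₀, -⟩ := hsurj s₀ hs₀ true
  have : Nonempty X := ⟨i₀⟩
  choose! g hg using hsurj
  have hg1 : ∀ s ∈ S, ∀ b, s ∈ N (g s b) := fun s hs b => by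
    have := hfN (g s b)
    rw [hg s hs b] at this
    simpa using this
  have hinj : ∀ s ∈ S, ∀ s' ∈ S, ∀ b b', g s b = g s' b' → s = s' ∧ b = b' := by
    intro s hs s' hs' b b' h
    have := hg s hs b
    rw [h, hg s' hs' b'] at this
    simpa [eq_comm] using this
  have hg2 : ∀ i : X, ∃ s ∈ S, ∃ b, g s b = i := by
    intro i
    have : f i ∈ S ×ˢ (univ : Finset Bool) := by rw [← himg]; simp
    refine ⟨(f i).1, by simpa using this, (f i).2, hf ?_⟩
    rw [hg _ (by simpa using this)]
  have hdis : ∀ i j : X, i ≠ j → Disjoint (P i) (P j) := fun i j hij =>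
    hP i.2 j.2 fun h => hij (Subtype.ext h)
  have hcov : Cov G (S.biUnion fun s => insert s (P (g s true) ∪ P (g s false))) := by
    refine Cov.biUnion ?_ ?_
    · intro s hs
      obtain ⟨v, hv, hr⟩ := hroot _ (g s true).2 s (hg1 s hs true)
      obtain ⟨v', hv', hr'⟩ := hroot _ (g s false).2 s (hg1 s hs false)
      refine hr.cov_join hr' (hdis _ _ fun h => ?_) ?_ ?_ hv hv'
      · simpa using (hinj s hs s hs _ _ h).2
      · exact disjoint_right.1 (hPS _ (g s true).2) hs
      · exact disjoint_right.1 (hPS _ (g s false).2) hs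
    · intro s hs s' hs' hss
      have h0 : ∀ b b', Disjoint (P (g s b)) (P (g s' b')) := fun b b' =>
        hdis _ _ fun h => hss (hinj s hs s' hs' _ _ h).1
      have h1 : ∀ b, s ∉ P (g s' b) := fun b =>
        disjoint_right.1 (hPS _ (g s' b).2) hs
      have h2 : ∀ b, s' ∉ P (g s b) := fun b =>
        disjoint_right.1 (hPS _ (g s b).2) hs'
      simp only [Function.onFun, disjoint_insert_left, disjoint_insert_right, disjoint_union_left,
        disjoint_union_right, mem_insert, mem_union, not_or]
      simp [h0, h1, h2]
      exact fun h => hss h.symm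
  convert hcov using 1
  ext x
  simp only [mem_union, mem_biUnion, mem_insert]
  constructor
  · rintro (hx | ⟨i, hi, hx⟩)
    · exact ⟨x, hx, .inl rfl⟩
    · obtain ⟨s, hs, b, hb⟩ := hg2 ⟨i, hi⟩
      refine ⟨s, hs, .inr ?_⟩
      have : i = g s b := by rw [hb]
      subst this
      cases b <;> tauto
  · rintro ⟨s, hs, rfl | hx | hx⟩
    · exact .inl hs
    · exact .inr ⟨_, (g s true).2, hx⟩
    · exact .inr ⟨_, (g s false).2, hx⟩

open Classical in
/-- The vertices of `S` having a neighbour in `C`. -/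
noncomputable def nbrs (G : SimpleGraph V) (S C : Finset V) : Finset V :=
  S.filter fun s => ∃ u ∈ C, G.Adj s u

lemma mem_nbrs {s : V} : s ∈ nbrs G S C ↔ s ∈ S ∧ ∃ u ∈ C, G.Adj s u := by
  simp [nbrs]

lemma mem_suns_of_nbrs_subset {N : Finset V} (hC : C ∈ suns G (A \ S)) (hN : N ⊆ S)
    (h : nbrs G S C ⊆ N) : C ∈ suns G (A \ N) := by
  obtain ⟨hC, hs⟩ := mem_suns.1 hC
  refine mem_suns.2 ⟨hC.of_closed (sdiff_subset_sdiff le_rfl hN) fun x hx y hy hxy => ?_, hs⟩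
  rw [mem_sdiff] at hy ⊢
  exact ⟨hy.1, fun hyS => hy.2 (h (mem_nbrs.2 ⟨hyS, x, hx, hxy.symm⟩))⟩

lemma card_le_card_suns_biUnion_nbrs {Y : Finset (Finset V)} (hY : Y ⊆ suns G (A \ S))
    {N : Finset V} (hN : N ⊆ S) (h : ∀ C ∈ Y, nbrs G S C ⊆ N) :
    Y.card ≤ (suns G (A \ N)).card :=
  card_le_card fun C hC => mem_suns_of_nbrs_subset (hY hC) hN (h C hC)

/-- Covering a graph from a system of pieces attached in pairs to the vertices of `S`. -/
lemma cov_of_hall_of_isComp {ι : Type*} [DecidableEq ι] {X : Finset ι} {P N : ι → Finset V}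
    (hS : S ⊆ A) (hP : (X : Set ι).PairwiseDisjoint P)
    (hPA : ∀ i ∈ X, P i ⊆ A \ S) (hPcl : ∀ i ∈ X, ∀ x ∈ P i, ∀ y ∈ A \ S, G.Adj x y → y ∈ P i)
    (hN : ∀ i ∈ X, N i ⊆ S) (hcard : X.card = 2 * S.card)
    (hall : ∀ Y ⊆ X, Y.card ≤ 2 * (Y.biUnion N).card)
    (hroot : ∀ i ∈ X, ∀ s ∈ N i, ∃ v, G.Adj s v ∧ Root G (P i) v)
    (hcomp : ∀ C, IsComp G (A \ S) C → Disjoint C (X.biUnion P) → Cov G C) : Cov G A := by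
  have h1 := cov_of_hall hP (fun i hi => disjoint_left.2 fun x hx hxS =>
    (mem_sdiff.1 (hPA i hi hx)).2 hxS) hN hcard hall hroot
  have h2 : Cov G ((A \ S) \ X.biUnion P) := by
    refine cov_of_isComp fun C hC => hcomp C (hC.of_closed sdiff_subset ?_) ?_
    · intro x hx y hy hxy
      have hx' := mem_sdiff.1 (hC.subset hx)
      refine mem_sdiff.2 ⟨hy, fun h => hx'.2 ?_⟩
      obtain ⟨i, hi, hyi⟩ := mem_biUnion.1 h
      exact mem_biUnion.2 ⟨i, hi, hPcl i hi y hyi x hx'.1 hxy.symm⟩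
    · exact disjoint_left.2 fun x hx => (mem_sdiff.1 (hC.subset hx)).2
  convert h1.union h2 ?_ using 1
  · have : X.biUnion P ⊆ A \ S := biUnion_subset.2 hPA
    ext x
    have := @this x
    have := @hS x
    simp only [mem_union, mem_sdiff] at *
    tauto
  · rw [disjoint_union_left]
    exact ⟨disjoint_left.2 fun x hx h => by simp [hx] at h, disjoint_sdiff⟩

lemma cov_of_card_suns_eq (hK : Kan G A) (hS : S ⊆ A) (hcard : (suns G (A \ S)).card = 2 * S.card)
    (hcomp : ∀ C, IsComp G (A \ S) C → Kan G C → Cov G C) : Cov G A := by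
  refine cov_of_hall_of_isComp (X := suns G (A \ S)) (P := id) (N := nbrs G S) hS ?_ ?_ ?_ ?_
    hcard ?_ ?_ ?_
  · intro C hC D hD hne
    exact (mem_suns.1 hC).1.disjoint (mem_suns.1 hD).1 hne
  · exact fun C hC => (mem_suns.1 hC).1.subset
  · exact fun C hC => (mem_suns.1 hC).1.closed
  · exact fun C _ s hs => (mem_nbrs.1 hs).1
  · intro Y hY
    have hN : Y.biUnion (nbrs G S) ⊆ S := biUnion_subset.2 fun C _ s hs => (mem_nbrs.1 hs).1
    exact (card_le_card_suns_biUnion_nbrs hY hN fun C hC => subset_biUnion_of_mem _ hC).trans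
      (hK _ (hN.trans hS))
  · intro C hC s hs
    obtain ⟨-, u, hu, hsu⟩ := mem_nbrs.1 hs
    exact ⟨u, hsu, (mem_suns.1 hC).2.root hu⟩
  · intro C hC hdis
    have hns : ¬ SunOn G C := by
      intro h
      obtain ⟨x, hx⟩ := hC.nonempty
      exact disjoint_left.1 hdis hx (mem_biUnion.2 ⟨C, mem_suns.2 ⟨hC, h⟩, hx⟩)
    refine hcomp C hC fun T hT => ?_
    have h1 := card_suns_add_le hC hns hT
    rw [sdiff_sdiff_left] at h1
    have h2 := hK (S ∪ T) (union_subset hS (hT.trans (hC.subset.trans sdiff_subset)))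
    have h3 := card_union_le S T
    simp only [sup_eq_union] at h1
    omega

lemma Conn.exists_adj {b : V} (hA : Conn G A) (hb : b ∈ A) (hC : IsComp G (A.erase b) C) :
    ∃ u ∈ C, G.Adj b u := by
  by_contra! hcon
  have := hA C (hC.subset.trans (erase_subset _ _)) hC.nonempty fun x hx y hy hxy => by
    by_cases hyb : y = b
    · subst hyb; exact absurd hxy.symm (hcon x hx)
    · exact hC.closed x hx y (mem_erase.2 ⟨hyb, hy⟩) hxy
  rw [← this] at hb
  simpa using hC.subset hb

lemma isComp_singleton {b a : V} (ha : a ∈ A) (hab : Tip G A b a) : IsComp G (A.erase b) {a} := by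
  refine ⟨by simp [ha, hab.1.ne.symm], by simp, ?_, ?_⟩
  · intro X hX hne _
    exact (Finset.subset_singleton_iff.1 hX).resolve_left hne.ne_empty
  · simp only [mem_singleton, forall_eq, mem_erase]
    exact fun y hy h => absurd (hab.2 y hy.2 h) hy.1

lemma sunOn_singleton {a : V} : SunOn G {a} := .inl ⟨a, rfl⟩

/-- The situation of a connected non-sun `G[A]` in which no nonempty `S` attains equality, with
the induction hypothesis for smaller vertex sets. -/
structure Slack (G : SimpleGraph V) (A : Finset V) : Prop where
  kan : Kan G A
  conn : Conn G A
  slack : ∀ S ⊆ A, S.Nonempty → (suns G (A \ S)).card + 1 ≤ 2 * S.card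
  ih : ∀ B ⊂ A, Kan G B → Cov G B

namespace Slack

lemma cov_sdiff (h : Slack G A) {b : V} (hb : b ∈ A)
    (hC : C ∈ suns G (A.erase b)) : Cov G (A.erase b \ C) := by
  refine h.ih _ (Finset.ssubset_of_subset_of_ssubset sdiff_subset (erase_ssubset hb)) fun T hT => ?_
  have h1 := card_suns_sdiff_succ_le hC hT
  have h2 := h.slack (insert b T)
    (insert_subset hb (hT.trans (sdiff_subset.trans (erase_subset _ _)))) (by simp)
  have h3 := card_insert_le b T
  rw [sdiff_insert, ← sdiff_singleton_eq_erase, sdiff_sdiff_comm, sdiff_singleton_eq_erase] at h2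
  omega

lemma eq_singleton (h : Slack G A) (hnc : ¬ Cov G A) {b : V} (hb : b ∈ A)
    (hC : C ∈ suns G (A.erase b)) :
    ∃ a, C = {a} ∧ Tip G A b a := by
  obtain ⟨u, hu, hbu⟩ := h.conn.exists_adj hb (mem_suns.1 hC).1
  have hbC : b ∉ C := fun hbC => by simpa using (mem_suns.1 hC).1.subset hbC
  by_cases hCu : C = {u}
  · refine ⟨u, hCu, hbu, fun x hx hux => ?_⟩
    by_contra hxb
    have := (mem_suns.1 hC).1.closed u hu x (by simp [hx, hxb]) hux
    rw [hCu, mem_singleton] at this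
    subst this
    exact G.irrefl hux
  · refine absurd ?_ hnc
    have := ((mem_suns.1 hC).2.cov_insert hu hbC hbu hCu).union (h.cov_sdiff hb hC) (by
      rw [disjoint_insert_left]
      exact ⟨by simp, disjoint_sdiff⟩)
    convert this using 1
    have := (mem_suns.1 hC).1.subset
    ext x
    have := @this x
    simp at *
    grind

lemma tip_unique (h : Slack G A) {b a a' : V} (hb : b ∈ A) (ha : a ∈ A) (ha' : a' ∈ A)
    (hab : Tip G A b a)
    (hab' : Tip G A b a') : a = a' := by
  by_contra hne
  have h1 := h.slack {b} (by simpa) (by simp)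
  have h2 : ({{a}, {a'}} : Finset (Finset V)) ⊆ suns G (A \ {b}) := by
    rw [sdiff_singleton_eq_erase]
    simp only [insert_subset_iff, singleton_subset_iff]
    exact ⟨mem_suns.2 ⟨isComp_singleton ha hab, sunOn_singleton⟩,
      mem_suns.2 ⟨isComp_singleton ha' hab', sunOn_singleton⟩⟩
  have h3 := card_le_card h2
  rw [card_pair (by simpa using hne)] at h3
  simp at h1
  omega

lemma sunOn_of_tips (h : Slack G A)
    (hall : ∀ z ∈ A, (∃ b ∈ A, Tip G A b z) ∨ ∃ a ∈ A, Tip G A z a) :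
    SunOn G A := by
  classical
  by_cases hK2 : ∃ a ∈ A, ∃ b ∈ A, Tip G A a b ∧ Tip G A b a
  · obtain ⟨a, ha, b, hb, hab, hba⟩ := hK2
    have hA : {a, b} = A := by
      refine h.conn {a, b} (by simp [insert_subset_iff, ha, hb]) (by simp) ?_
      simp only [mem_insert, mem_singleton]
      rintro x (rfl | rfl) y hy hxy
      · exact .inr (hba.2 y hy hxy)
      · exact .inl (hab.2 y hy hxy)
    have hne := hab.1.ne
    refine IsCore.sunOn (R := {a}) (w := fun _ => b) ⟨?_, by simp, ?_, ?_, ?_, ?_⟩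
    · rw [← hA]; simp
    · simpa using hne.symm
    · simpa using hab.1
    · simpa using hab.2
    · simpa using PM.empty
  push Not at hK2
  have hex : ∀ r ∈ A.filter (fun b => ∃ a ∈ A, Tip G A b a), ∃ a ∈ A, Tip G A r a :=
    fun r hr => (mem_filter.1 hr).2
  generalize hR : A.filter (fun b => ∃ a ∈ A, Tip G A b a) = R at hex
  have hRmem : ∀ x, x ∈ R ↔ x ∈ A ∧ ∃ a ∈ A, Tip G A x a := by simp [← hR]
  choose! w hwA hw using hex
  have hwR : ∀ r ∈ R, w r ∉ R := fun r hr hwr =>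
    hK2 r ((hRmem r).1 hr).1 (w r) (hwA r hr) (hw r hr) (by
      obtain ⟨hwA', a, ha, ht⟩ := (hRmem _).1 hwr
      have : a = r := (hw r hr).2 a ha ht.1
      rwa [this] at ht)
  have heq : A = R ∪ R.image w := by
    ext x
    simp only [mem_union, mem_image]
    constructor
    · intro hx
      rcases hall x hx with ⟨b, hb, ht⟩ | ht
      · have hbR := (hRmem b).2 ⟨hb, x, hx, ht⟩
        exact .inr ⟨b, hbR, h.tip_unique hb (hwA b hbR) hx (hw b hbR) ht⟩
      · exact .inl ((hRmem x).2 ⟨hx, ht⟩)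
    · rintro (hx | ⟨r, hr, rfl⟩)
      · exact ((hRmem x).1 hx).1
      · exact hwA r hr
  have hinj : Set.InjOn w R := fun a ha b hb hab =>
    (hw b hb).2 a ((hRmem a).1 ha).1 (hab ▸ (hw a ha).1.symm)
  refine IsCore.sunOn ⟨heq, hinj, hwR, fun r hr => (hw r hr).1, fun r hr => (hw r hr).2, ?_⟩
  intro r hr
  have hrA := ((hRmem r).1 hr).1
  have hcov := h.cov_sdiff hrA
    (mem_suns.2 ⟨isComp_singleton (hwA r hr) (hw r hr), sunOn_singleton⟩)
  refine hcov.pm_of_tips (w := w) ?_ ?_ ?_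
  · rw [heq]
    ext x
    simp only [mem_sdiff, mem_erase, mem_singleton, mem_union, mem_image]
    constructor
    · rintro ⟨⟨hxr, hx | ⟨y, hy, rfl⟩⟩, hxw⟩
      · exact .inl ⟨hxr, hx⟩
      · exact .inr ⟨y, ⟨fun h => hxw (by rw [h]), hy⟩, rfl⟩
    · rintro (⟨hxr, hx⟩ | ⟨y, ⟨hyr, hy⟩, rfl⟩)
      · exact ⟨⟨hxr, .inl hx⟩, fun h => hwR r hr (h ▸ hx)⟩
      · exact ⟨⟨fun h => hwR y hy (h ▸ hr), .inr ⟨y, hy, rfl⟩⟩, fun h => hyr (hinj hy hr h)⟩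
  · exact fun x hx hx' => hwR x (mem_of_mem_erase hx) (mem_of_mem_erase hx')
  · intro x hx y hy
    simp only [mem_sdiff, mem_erase] at hx hy
    exact (hw x hx.2).2 y hy.1.2

/-- In the presence of slack, a vertex of neither kind in a sun allows the deletion of any of its
edges. -/
lemma cov_of_deleteEdge (h : Slack G A) (hns : ¬ SunOn G A) {z v : V} (hz : z ∈ A) (hv : v ∈ A)
    (hzv : G.Adj z v) (hz1 : ∀ b ∈ A, ¬ Tip G A b z) (hz2 : ∀ a ∈ A, ¬ Tip G A z a)
    (hK : ¬ Kan (G.deleteEdges {s(z, v)}) A) : Cov G A := by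
  by_contra hnc
  have hle : G.deleteEdges {s(z, v)} ≤ G := G.deleteEdges_le _
  have hadj : ∀ x y, G.Adj x y → (G.deleteEdges {s(z, v)}).Adj x y ∨
      (x = z ∧ y = v) ∨ (x = v ∧ y = z) := by
    intro x y hxy
    simp only [SimpleGraph.deleteEdges_adj, Set.mem_singleton_iff, Sym2.eq_iff]
    tauto
  have hnzv : ¬ (G.deleteEdges {s(z, v)}).Adj z v := by simp
  generalize G.deleteEdges {s(z, v)} = G' at *
  simp only [Kan, not_forall, not_le] at hK
  obtain ⟨S, hS, hlt⟩ := hK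
  have hzv' := hzv.ne
  -- components of `G'` avoiding the ends of the deleted edge are components of `G`
  have hPM : ∀ B, PM G' B → PM G B := by
    intro B hB
    induction hB with
    | empty => exact .empty
    | pair h ha hb _ ih => exact .pair (hle h) ha hb ih
  have hadj' : ∀ C : Finset V, z ∉ C ∨ v ∉ C → ∀ x ∈ C, ∀ y ∈ C, G.Adj x y → G'.Adj x y := by
    intro C hC x hx y hy hxy
    rcases hadj x y hxy with h | ⟨rfl, rfl⟩ | ⟨rfl, rfl⟩ <;> tauto
  have hsun : ∀ C, z ∉ C ∨ v ∉ C → SunOn G' C → SunOn G C := by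
    intro C hC hs
    rcases hs with hs | ⟨R, hR, h1, h2, h3⟩
    · exact .inl hs
    refine .inr ⟨R, hR, ?_, ?_, fun r hr => hPM _ (h3 r hr)⟩
    · intro r hr
      obtain ⟨y, hy, ht, hu⟩ := h1 r hr
      refine ⟨y, hy, ⟨hle ht.1, fun x hx hyx => ht.2 x hx ?_⟩, fun y' hy' hr' => hu y' hy' ?_⟩
      · exact hadj' C hC y (mem_sdiff.1 hy).1 x hx hyx
      · exact hadj' C hC r (hR hr) y' (mem_sdiff.1 hy').1 hr'
    · intro y hy
      obtain ⟨r, hr, ht⟩ := h2 y hy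
      exact ⟨r, hr, hle ht.1, fun x hx hyx => ht.2 x hx
        (hadj' C hC y (mem_sdiff.1 hy).1 x hx hyx)⟩
  have hconn : ∀ C, Conn G' C → Conn G C := fun C hC X hX hne hcl =>
    hC X hX hne fun x hx y hy hxy => hcl x hx y hy (hle hxy)
  have hsuns : ∀ C ∈ suns G' (A \ S), z ∉ C → v ∉ C → C ∈ suns G (A \ S) := by
    intro C hC hzC hvC
    obtain ⟨hC, hs⟩ := mem_suns.1 hC
    refine mem_suns.2 ⟨⟨hC.subset, hC.nonempty, hconn C hC.conn, fun x hx y hy hxy => ?_⟩,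
      hsun C (.inl hzC) hs⟩
    rcases hadj x y hxy with h | ⟨rfl, rfl⟩ | ⟨rfl, rfl⟩
    · exact hC.closed x hx y hy h
    · exact absurd hx hzC
    · exact absurd hx hvC
  -- a sun component containing exactly one end and sending no edges to `S`
  have hend : ∀ p q, (p = z ∧ q = v ∨ p = v ∧ q = z) → ∀ C ∈ suns G' (A \ S), p ∈ C → q ∉ C →
      nbrs G S C = ∅ → False := by
    intro p q hpq C hC hp hq hN
    have hqA : q ∈ A := by rcases hpq with ⟨-, rfl⟩ | ⟨-, rfl⟩ <;> assumption
    have hpA : p ∈ A := by rcases hpq with ⟨rfl, -⟩ | ⟨rfl, -⟩ <;> assumption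
    have hpqA : G.Adj q p := by
      rcases hpq with ⟨rfl, rfl⟩ | ⟨rfl, rfl⟩
      · exact hzv.symm
      · exact hzv
    obtain ⟨hC, hs⟩ := mem_suns.1 hC
    have hCs : C ∈ suns G (A.erase q) := by
      refine mem_suns.2 ⟨⟨?_, hC.nonempty, hconn C hC.conn, fun x hx y hy hxy => ?_⟩,
        hsun C (by rcases hpq with ⟨rfl, rfl⟩ | ⟨rfl, rfl⟩ <;> tauto) hs⟩
      · intro x hx
        have := hC.subset hx
        simp only [mem_sdiff, mem_erase] at this ⊢
        exact ⟨by rintro rfl; exact hq hx, this.1⟩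
      · rw [mem_erase] at hy
        have hyS : y ∉ S := fun hyS => by
          have : y ∈ nbrs G S C := mem_nbrs.2 ⟨hyS, x, hx, hxy.symm⟩
          rw [hN] at this
          simp at this
        rcases hadj x y hxy with h | ⟨rfl, rfl⟩ | ⟨rfl, rfl⟩
        · exact hC.closed x hx y (by simp [hy.2, hyS]) h
        · rcases hpq with ⟨rfl, rfl⟩ | ⟨rfl, rfl⟩ <;> tauto
        · rcases hpq with ⟨rfl, rfl⟩ | ⟨rfl, rfl⟩ <;> tauto
    obtain ⟨a, rfl, ha⟩ := h.eq_singleton hnc hqA hCs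
    rw [mem_singleton] at hp
    subst hp
    rcases hpq with ⟨rfl, rfl⟩ | ⟨rfl, rfl⟩
    · exact hz1 q hqA ha
    · exact hz2 p hpA ha
  rcases S.eq_empty_or_nonempty with rfl | hSne
  · simp only [card_empty, mul_zero, card_pos] at hlt
    obtain ⟨C, hC⟩ := hlt
    have hCA := (mem_suns.1 hC).1
    rw [sdiff_empty] at hCA
    by_cases hzC : z ∈ C <;> by_cases hvC : v ∈ C
    · have : C = A := h.conn C hCA.subset hCA.nonempty fun x hx y hy hxy => by
        rcases hadj x y hxy with h | ⟨rfl, rfl⟩ | ⟨rfl, rfl⟩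
        · exact hCA.closed x hx y hy h
        · exact hvC
        · exact hzC
      subst this
      rcases (mem_suns.1 hC).2.twoRoot hz with h' | ⟨y, hy, ht, -⟩
      · exact hnc ((h' v hv).cov_of_adj hle hzv' hnzv hzv)
      · refine hz2 y hy ⟨hle ht.1, fun x hx hyx => ?_⟩
        rcases hadj y x hyx with h | ⟨rfl, rfl⟩ | ⟨rfl, rfl⟩
        · exact ht.2 x hx h
        · exact absurd ht.1 G'.irrefl
        · rfl
    · exact hend z v (.inl ⟨rfl, rfl⟩) C hC hzC hvC (by simp [nbrs])
    · exact hend v z (.inr ⟨rfl, rfl⟩) C hC hvC hzC (by simp [nbrs])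
    · have := card_pos.2 ⟨C, hsuns C hC hzC hvC⟩
      have := h.kan ∅ (by simp)
      simp only [card_empty, mul_zero] at this
      omega
  have hsl := h.slack S hS hSne
  -- the two sun components joined by the deleted edge
  obtain ⟨C₂, hC₂, C₁, hC₁, hz₂, hv₁, hz₁, hv₂⟩ : ∃ C₂ ∈ suns G' (A \ S),
      ∃ C₁ ∈ suns G' (A \ S), z ∈ C₂ ∧ v ∈ C₁ ∧ z ∉ C₁ ∧ v ∉ C₂ := by
    have h2 : 1 < ((suns G' (A \ S)).filter fun C => ¬ (z ∉ C ∧ v ∉ C)).card := by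
      have h3 := card_filter_add_card_filter_not (s := suns G' (A \ S)) fun C => z ∉ C ∧ v ∉ C
      have h4 : ((suns G' (A \ S)).filter fun C => z ∉ C ∧ v ∉ C).card ≤
          (suns G (A \ S)).card := card_le_card fun C hC => by
        rw [mem_filter] at hC
        exact hsuns C hC.1 hC.2.1 hC.2.2
      omega
    obtain ⟨C, hC, D, hD, hne⟩ := one_lt_card.1 h2
    simp only [mem_filter, not_and_or, not_not] at hC hD
    have hdis := disjoint_left.1 ((mem_suns.1 hC.1).1.disjoint (mem_suns.1 hD.1).1 hne)
    have hdz := @hdis z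
    have hdv := @hdis v
    by_cases hzC : z ∈ C
    · exact ⟨C, hC.1, D, hD.1, by tauto⟩
    · exact ⟨D, hD.1, C, hC.1, by tauto⟩
  have hc₁ := (mem_suns.1 hC₁).1
  have hc₂ := (mem_suns.1 hC₂).1
  have hdis₁₂ : Disjoint C₂ C₁ := hc₂.disjoint hc₁ (by rintro rfl; exact hz₁ hz₂)
  have hs₁ := hsun C₁ (.inl hz₁) (mem_suns.1 hC₁).2
  have hs₂ := hsun C₂ (.inr hv₂) (mem_suns.1 hC₂).2
  have hcl : ∀ x ∈ C₂ ∪ C₁, ∀ y ∈ A \ S, G.Adj x y → y ∈ C₂ ∪ C₁ := by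
    intro x hx y hy hxy
    rw [mem_union] at hx ⊢
    rcases hadj x y hxy with h | ⟨rfl, rfl⟩ | ⟨rfl, rfl⟩
    · exact hx.imp (fun hx => hc₂.closed x hx y hy h) fun hx => hc₁.closed x hx y hy h
    · exact .inr hv₁
    · exact .inl hz₂
  have hcardS : (suns G (A \ S)).card + 1 = 2 * S.card := by
    have h5 : suns G' (A \ S) ⊆ insert C₂ (insert C₁ (suns G (A \ S))) := by
      intro C hC
      by_cases hzC : z ∈ C
      · simp [(mem_suns.1 hC).1.eq_of_mem hc₂ hzC hz₂]
      by_cases hvC : v ∈ C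
      · simp [(mem_suns.1 hC).1.eq_of_mem hc₁ hvC hv₁]
      · simp [hsuns C hC hzC hvC]
    have := card_le_card h5
    have := card_insert_le C₂ (insert C₁ (suns G (A \ S)))
    have := card_insert_le C₁ (suns G (A \ S))
    omega
  have hc₁₂ : ∀ C ∈ suns G (A \ S), Disjoint C (C₂ ∪ C₁) := by
    intro C hC
    by_contra hnd
    obtain ⟨x, hx, hx'⟩ := not_disjoint_iff.1 hnd
    obtain ⟨hC, hs⟩ := mem_suns.1 hC
    -- such a component would give too many suns
    have h6 : suns G' (A \ S) ⊆ insert C₂ (insert C₁ ((suns G (A \ S)).erase C)) := by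
      intro D hD
      by_cases hzC : z ∈ D
      · simp [(mem_suns.1 hD).1.eq_of_mem hc₂ hzC hz₂]
      by_cases hvC : v ∈ D
      · simp [(mem_suns.1 hD).1.eq_of_mem hc₁ hvC hv₁]
      · simp only [mem_insert, mem_erase, hsuns D hD hzC hvC, and_true]
        by_cases hDC : D = C
        · subst hDC
          rcases mem_union.1 hx' with hx' | hx'
          · exact .inl ((mem_suns.1 hD).1.eq_of_mem hc₂ hx hx')
          · exact .inr (.inl ((mem_suns.1 hD).1.eq_of_mem hc₁ hx hx'))
        · exact .inr (.inr hDC)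
    have h7 := card_le_card h6
    have h8 := card_insert_le C₂ (insert C₁ ((suns G (A \ S)).erase C))
    have h9 := card_insert_le C₁ ((suns G (A \ S)).erase C)
    have h10 := card_erase_of_mem (mem_suns.2 ⟨hC, hs⟩)
    have h11 := card_pos.2 ⟨C, mem_suns.2 ⟨hC, hs⟩⟩
    omega
  -- it suffices to attach the union of the two suns to a vertex of `S`
  have key : ∀ s ∈ S, ∀ u ∈ C₂, G.Adj s u → ¬ TwoRoot G C₂ z u := by
    intro s hs u hu hsu htr
    have hroot := htr.root_union (hs₁.root hv₁) hdis₁₂ hzv.symm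
    have hC₂n : C₂ ∉ suns G (A \ S) := fun hmem =>
      disjoint_left.1 (hc₁₂ C₂ hmem) hz₂ (mem_union_left _ hz₂)
    apply hnc
    have hXne : ∀ C ∈ suns G (A \ S), C ≠ C₂ := by rintro C hC rfl; exact hC₂n hC
    refine cov_of_hall_of_isComp (S := S) (X := insert C₂ (suns G (A \ S)))
      (P := fun C => if C = C₂ then C₂ ∪ C₁ else C)
      (N := fun C => if C = C₂ then {s} else nbrs G S C) hS ?_ ?_ ?_ ?_ ?_ ?_ ?_ ?_
    · intro C hC D hD hne
      simp only [coe_insert, Set.mem_insert_iff, mem_coe] at hC hD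
      rcases hC with rfl | hC <;> rcases hD with rfl | hD
      · exact absurd rfl hne
      · simpa [Function.onFun, hne.symm] using (hc₁₂ D hD).symm
      · simpa [Function.onFun, hne] using hc₁₂ C hC
      · simpa [Function.onFun, hXne C hC, hXne D hD] using
          (mem_suns.1 hC).1.disjoint (mem_suns.1 hD).1 hne
    · intro C hC
      rcases mem_insert.1 hC with rfl | hC
      · simpa using union_subset hc₂.subset hc₁.subset
      · simpa [hXne C hC] using (mem_suns.1 hC).1.subset
    · intro C hC
      rcases mem_insert.1 hC with rfl | hC
      · simpa using hcl
      · simpa [hXne C hC] using (mem_suns.1 hC).1.closed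
    · intro C hC
      rcases mem_insert.1 hC with rfl | hC
      · simpa using hs
      · have : nbrs G S C ⊆ S := fun s hs => (mem_nbrs.1 hs).1
        simpa [hXne C hC] using this
    · rw [card_insert_of_notMem hC₂n, hcardS]
    · intro Y hY
      have hNS : ∀ C ∈ Y, (if C = C₂ then {s} else nbrs G S C) ⊆ S := by
        intro C hC
        split_ifs
        · simpa
        · exact fun s hs => (mem_nbrs.1 hs).1
      have hN := biUnion_subset.2 hNS
      have hle := card_le_card_suns_biUnion_nbrs (Y := Y.erase C₂) (G := G) (A := A) (fun C hC =>
        (mem_insert.1 (hY (mem_of_mem_erase hC))).resolve_left (ne_of_mem_erase hC)) hN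
        fun C hC => by
          have := subset_biUnion_of_mem (fun C => if C = C₂ then {s} else nbrs G S C)
            (mem_of_mem_erase hC)
          simpa [ne_of_mem_erase hC] using this
      by_cases hC₂Y : C₂ ∈ Y
      · have := h.slack _ (hN.trans hS) ⟨s, mem_biUnion.2 ⟨C₂, hC₂Y, by simp⟩⟩
        rw [card_erase_of_mem hC₂Y] at hle
        omega
      · rw [erase_eq_of_notMem hC₂Y] at hle
        exact hle.trans (h.kan _ (hN.trans hS))
    · intro C hC s' hs'
      rcases mem_insert.1 hC with rfl | hC
      · simp only [if_true, mem_singleton] at hs' ⊢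
        subst hs'
        exact ⟨u, hsu, hroot⟩
      · simp only [hXne C hC, if_false] at hs' ⊢
        obtain ⟨-, u', hu', hsu'⟩ := mem_nbrs.1 hs'
        exact ⟨u', hsu', (mem_suns.1 hC).2.root hu'⟩
    · intro C hC hdis
      have hns : ¬ SunOn G C := by
        intro h
        obtain ⟨x, hx⟩ := hC.nonempty
        have hCs := mem_suns.2 ⟨hC, h⟩
        refine disjoint_left.1 hdis hx (mem_biUnion.2 ⟨C, by simp [hCs], ?_⟩)
        simpa [hXne C hCs]
      refine h.ih C ?_ fun T hT => ?_
      · obtain ⟨s, hs⟩ := hSne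
        refine Finset.ssubset_of_subset_of_ssubset hC.subset ((ssubset_iff_of_subset sdiff_subset).2
          ⟨s, hS hs, by simp [hs]⟩)
      · have h1 := card_suns_add_le hC hns hT
        rw [sdiff_sdiff_left] at h1
        have h2 := h.slack (S ∪ T) (union_subset hS (hT.trans (hC.subset.trans sdiff_subset)))
          (hSne.mono subset_union_left)
        have h3 := card_union_le S T
        simp only [sup_eq_union] at h1
        omega
  obtain ⟨s, hs⟩ : (nbrs G S C₂).Nonempty := by
    by_contra hN
    exact hend z v (.inl ⟨rfl, rfl⟩) C₂ hC₂ hz₂ hv₂ (not_nonempty_iff_eq_empty.1 hN)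
  obtain ⟨hsS, u, hu, hsu⟩ := mem_nbrs.1 hs
  rcases hs₂.twoRoot hz₂ with htr | ⟨y, hy, ht, htr⟩
  · exact key s hsS u hu hsu (htr u hu)
  · have hyA := mem_sdiff.1 (hc₂.subset hy)
    refine hz2 y hyA.1 ⟨ht.1, fun x hx hyx => ?_⟩
    have hyz : y ≠ z := ht.1.ne.symm
    by_cases hxS : x ∈ S
    · exact absurd htr (key x hxS y hy hyx.symm)
    · rcases hadj y x hyx with h | ⟨rfl, rfl⟩ | ⟨rfl, rfl⟩
      · exact ht.2 x (hc₂.closed y hy x (by simp [hx, hxS]) h) hyx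
      · exact absurd rfl hyz
      · exact absurd hy hv₂

end Slack

/-- **Kaneko's theorem**: the condition `sun(G - S) ≤ 2|S|` for all `S` suffices for the existence
of a path factor with all paths having at least three vertices. -/
theorem Kan.cov [Finite V] (hK : Kan G A) : Cov G A := by
  induction hn : A.card + G.edgeSet.ncard using Nat.strong_induction_on generalizing G A with
  | _ n ih =>
    by_contra hnc
    have ihA : ∀ B ⊂ A, Kan G B → Cov G B := fun B hB hKB =>
      ih _ (by have := card_lt_card hB; omega) hKB rfl
    have hconn : Conn G A := by
      intro X hX hne hcl
      by_contra hXA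
      refine hnc (cov_of_card_suns_eq hK (empty_subset A) ?_ fun C hC hKC => ihA C ?_ hKC)
      · have := hK ∅ (empty_subset A)
        simp only [card_empty, mul_zero] at this ⊢
        omega
      · rw [sdiff_empty] at hC
        refine hC.subset.ssubset_of_ne ?_
        rintro rfl
        exact hXA (hC.conn X hX hne hcl)
    have hslack : ∀ S ⊆ A, S.Nonempty → (suns G (A \ S)).card + 1 ≤ 2 * S.card := by
      intro S hS hne
      by_contra hlt
      refine hnc (cov_of_card_suns_eq hK hS (by have := hK S hS; omega)
        fun C hC hKC => ihA C ?_ hKC)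
      obtain ⟨s, hs⟩ := hne
      exact Finset.ssubset_of_subset_of_ssubset hC.subset ((ssubset_iff_of_subset sdiff_subset).2
        ⟨s, hS hs, by simp [hs]⟩)
    have hsl : Slack G A := ⟨hK, hconn, hslack, ihA⟩
    have hAne : A.Nonempty := by
      rw [nonempty_iff_ne_empty]
      rintro rfl
      exact hnc .empty
    have hns : ¬ SunOn G A := by
      intro h
      have h1 := hK ∅ (empty_subset A)
      have h2 : A ∈ suns G (A \ ∅) := by
        rw [sdiff_empty]
        exact mem_suns.2 ⟨⟨le_rfl, hAne, hconn, fun _ _ y hy _ => hy⟩, h⟩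
      have := card_pos.2 ⟨A, h2⟩
      simp only [card_empty, mul_zero] at h1
      omega
    obtain ⟨z, hz, hz1, hz2⟩ : ∃ z ∈ A, (∀ b ∈ A, ¬ Tip G A b z) ∧ ∀ a ∈ A, ¬ Tip G A z a := by
      by_contra! hcon
      refine hns (hsl.sunOn_of_tips fun z hz => ?_)
      by_cases h : ∃ b ∈ A, Tip G A b z
      · exact .inl h
      · push Not at h
        exact .inr (hcon z hz h)
    obtain ⟨v, hv, hzv⟩ : ∃ v ∈ A, G.Adj z v := by
      by_contra! hcon
      refine hns (.inl ⟨z, (hconn {z} (by simpa) (by simp) ?_).symm⟩)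
      simp only [mem_singleton, forall_eq]
      exact fun y hy h => absurd h (hcon y hy)
    refine hnc (hsl.cov_of_deleteEdge hns hz hv hzv hz1 hz2 fun hK' => hnc ?_)
    refine (ih _ ?_ hK' rfl).mono (G.deleteEdges_le _)
    have : (G.deleteEdges {s(z, v)}).edgeSet.ncard < G.edgeSet.ncard := by
      refine Set.ncard_lt_ncard ?_ (Set.toFinite _)
      rw [SimpleGraph.edgeSet_deleteEdges]
      exact ⟨Set.sdiff_subset, fun hcon => (hcon (show s(z, v) ∈ G.edgeSet from hzv)).2 rfl⟩
    omega

/-! ### From path systems to factors -/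

/-- `F` is a subgraph of `G[B]` all of whose components meeting `B` are paths on three, four or
five vertices. -/
def IsFactorOn (G : SimpleGraph V) (B : Finset V) (F : SimpleGraph V) : Prop :=
  F ≤ G ∧ (∀ x y, F.Adj x y → x ∈ B) ∧ ∀ x ∈ B, ∃ n, (n = 3 ∨ n = 4 ∨ n = 5) ∧
    ∃ f : SimpleGraph.pathGraph n ↪g F, x ∈ Set.range f ∧ ∀ i y, F.Adj (f i) y → y ∈ Set.range f

lemma IsFactorOn.exists_union_of_length_le {F : SimpleGraph V} (h : IsFactorOn G B F) {l : List V}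
    (hc : l.IsChain G.Adj) (hn : l.Nodup) (h3 : 3 ≤ l.length) (h5 : l.length ≤ 5)
    (hd : ∀ x ∈ l, x ∉ B) : ∃ F', IsFactorOn G (l.toFinset ∪ B) F' := by
  obtain ⟨hle, hB, hF⟩ := h
  let e : Fin l.length ↪ V := ⟨l.get, List.nodup_iff_injective_get.1 hn⟩
  have he : ∀ i, e i ∈ l := fun i => List.get_mem l i
  have hemap : ∀ x y, ((SimpleGraph.pathGraph l.length).map e).Adj x y → x ∈ l := by
    intro x y hxy
    obtain ⟨i, j, -, rfl, -⟩ := (SimpleGraph.map_adj e _ x y).1 hxy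
    exact he i
  have hchain := List.isChain_iff_getElem.1 hc
  refine ⟨F ⊔ (SimpleGraph.pathGraph l.length).map e, sup_le hle ?_, ?_, ?_⟩
  · intro x y hxy
    obtain ⟨i, j, hij, rfl, rfl⟩ := (SimpleGraph.map_adj e _ x y).1 hxy
    rcases SimpleGraph.pathGraph_adj.1 hij with h | h
    · have := hchain i.1 (by omega)
      simp only [h] at this
      exact this
    · have := hchain j.1 (by omega)
      simp only [h] at this
      exact this.symm
  · rintro x y (h | h)
    · exact mem_union_right _ (hB x y h)
    · exact mem_union_left _ (List.mem_toFinset.2 (hemap x y h))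
  · intro x hx
    rcases mem_union.1 hx with hx | hx
    · refine ⟨l.length, by omega, ⟨e, ?_⟩, ?_, ?_⟩
      · intro i j
        simp only [SimpleGraph.sup_adj, SimpleGraph.map_adj_apply, or_iff_right_iff_imp]
        exact fun h => absurd (hB _ _ h) (hd _ (he i))
      · exact List.mem_iff_get.1 (List.mem_toFinset.1 hx)
      · rintro i y (h | h)
        · exact absurd (hB _ _ h) (hd _ (he i))
        · exact List.mem_iff_get.1 (hemap _ _ h.symm)
    · obtain ⟨n, hn, f, hf, hcl⟩ := hF x hx
      have hfB : ∀ i, f i ∈ B := by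
        intro i
        have : Nontrivial (Fin n) := Fin.nontrivial_iff_two_le.2 (by omega)
        have hpre : (SimpleGraph.pathGraph n).Preconnected := SimpleGraph.pathGraph_preconnected n
        obtain ⟨j, hij⟩ := hpre.exists_adj_of_nontrivial i
        exact hB _ _ (f.map_adj_iff.2 hij)
      refine ⟨n, hn, ⟨f.toEmbedding, ?_⟩, hf, ?_⟩
      · intro i j
        simp only [SimpleGraph.sup_adj]
        refine ⟨?_, fun h => .inl (f.map_adj_iff.2 h)⟩
        rintro (h | h)
        · exact f.map_adj_iff.1 h
        · exact absurd (hfB i) (hd _ (hemap _ _ h))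
      · rintro i y (h | h)
        · exact hcl i y h
        · exact absurd (hfB i) (hd _ (hemap _ _ h))

lemma IsFactorOn.exists_union {F : SimpleGraph V} (h : IsFactorOn G B F) {l : List V}
    (hc : l.IsChain G.Adj) (hn : l.Nodup) (h3 : 3 ≤ l.length) (hd : ∀ x ∈ l, x ∉ B) :
    ∃ F', IsFactorOn G (l.toFinset ∪ B) F' := by
  induction hk : l.length using Nat.strong_induction_on generalizing l with
  | _ k ih =>
    by_cases h5 : l.length ≤ 5
    · exact h.exists_union_of_length_le hc hn h3 h5 hd
    rw [← List.take_append_drop 3 l] at hc hn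
    obtain ⟨F', hF'⟩ := ih (l.drop 3).length (by simp; omega) hc.right_of_append
      (List.nodup_append.1 hn).2.1 (by simp; omega) (fun x hx => hd x (List.mem_of_mem_drop hx)) rfl
    obtain ⟨F'', hF''⟩ := hF'.exists_union_of_length_le hc.left_of_append
      (List.nodup_append.1 hn).1 (by simp; omega) (by simp) (fun x hx => by
        simp only [mem_union, List.mem_toFinset, not_or]
        exact ⟨fun h => (List.nodup_append.1 hn).2.2 x hx x h rfl, hd x (List.mem_of_mem_take hx)⟩)
    refine ⟨F'', ?_⟩
    rwa [← union_assoc, ← List.toFinset_append, List.take_append_drop] at hF''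

lemma Cov.exists_isFactorOn (h : Cov G B) : ∃ F, IsFactorOn G B F := by
  induction h with
  | empty => exact ⟨⊥, bot_le, by simp, by simp⟩
  | path hc hn h3 hd _ ih =>
    obtain ⟨F, hF⟩ := ih
    exact hF.exists_union hc hn h3 hd

lemma mem_of_reachable {W : Type*} {H : SimpleGraph W} {X : Set W}
    (hX : ∀ x ∈ X, ∀ y, H.Adj x y → y ∈ X) {x y : W} (hx : x ∈ X) (h : H.Reachable x y) :
    y ∈ X := by
  obtain ⟨p⟩ := h
  induction p with
  | nil => exact hx
  | cons hxy _ ih => exact ih (hX _ hx _ hxy)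

lemma Cov.hasPPPFactor [Fintype V] (h : Cov G univ) : HasPPPFactor G := by
  obtain ⟨F, hle, -, hF⟩ := h.exists_isFactorOn
  refine ⟨F, hle, fun c => ?_⟩
  obtain ⟨x, rfl⟩ : ∃ x, F.connectedComponentMk x = c := c.exists_rep
  obtain ⟨n, hn, f, ⟨i, rfl⟩, hcl⟩ := hF x (mem_univ x)
  have hsupp : (F.connectedComponentMk (f i)).supp = Set.range f := by
    ext y
    rw [SimpleGraph.ConnectedComponent.mem_supp_iff, SimpleGraph.ConnectedComponent.eq]
    constructor
    · exact fun h => mem_of_reachable (by rintro _ ⟨j, rfl⟩ z; exact hcl j z) ⟨i, rfl⟩ h.symm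
    · rintro ⟨j, rfl⟩
      exact (SimpleGraph.pathGraph_preconnected n j i).map f.toHom
  have hp : IsPathOn (F.induce (Set.range f)) n := ⟨f.isoInduceRange.symm⟩
  rw [← hsupp] at hp
  rcases hn with rfl | rfl | rfl
  · exact .inl hp
  · exact .inr (.inl hp)
  · exact .inr (.inr hp)

/-! ### Restriction to a vertex set -/

section Comap

variable {W : Type*} (φ : W ↪ V)

lemma Cov.comap [DecidableEq W] (h : Cov G B) (hB : (B : Set V) ⊆ Set.range φ) :
    Cov (G.comap φ) (B.preimage φ φ.injective.injOn) := by
  induction h with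
  | empty => simpa using Cov.empty
  | @path l B' hc hn h3 hd _ ih =>
    rw [coe_union, Set.union_subset_iff] at hB
    obtain ⟨l, rfl⟩ : ∃ l' : List W, l'.map φ = l := by
      rw [← Set.mem_range, Set.range_list_map]
      exact fun x hx => hB.1 (by simpa using hx)
    have := Cov.path (l := l) (B := B'.preimage φ φ.injective.injOn)
      ((List.isChain_map φ).1 hc) (hn.of_map φ) (by simpa using h3)
      (fun x hx hx' => hd (φ x) (List.mem_map_of_mem hx) (by simpa using hx'))
      (ih hB.2)
    convert this using 1
    ext x
    simp only [mem_preimage, mem_union, List.mem_toFinset, List.mem_map_of_injective φ.injective]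

lemma pm_iff_exists_isPerfectMatching [Fintype W] :
    (∃ M : (G.comap φ).Subgraph, M.IsPerfectMatching) ↔ PM G (univ.map φ) := by
  classical
  constructor
  · rintro ⟨M, hM⟩
    rw [SimpleGraph.Subgraph.isPerfectMatching_iff] at hM
    suffices ∀ X : Finset W, (∀ x ∈ X, ∀ y, M.Adj x y → y ∈ X) → PM G (X.map φ) from
      this univ fun _ _ y _ => mem_univ y
    intro X hX
    induction X using Finset.strongInduction with
    | H X ih =>
      rcases X.eq_empty_or_nonempty with rfl | ⟨a, ha⟩
      · exact .empty
      obtain ⟨b, hab, hb⟩ := hM a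
      have hbX := hX a ha b hab
      have hne : a ≠ b := hab.ne
      have hX' : X = insert a (insert b ((X.erase a).erase b)) := by
        rw [insert_erase (by simp [hne.symm, hbX]), insert_erase ha]
      rw [hX', map_insert, map_insert]
      refine .pair (M.adj_sub hab) (by simp) (by simp) (ih _ ?_ ?_)
      · exact Finset.ssubset_of_subset_of_ssubset (erase_subset _ _) (erase_ssubset ha)
      · intro x hx y hxy
        simp only [mem_erase] at hx ⊢
        refine ⟨?_, ?_, hX x hx.2.2 y hxy⟩
        · rintro rfl
          exact hx.2.1 ((hM y).unique hxy.symm hab.symm)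
        · rintro rfl
          exact hx.1 (hb x hxy.symm)
  · intro h
    suffices ∀ X, PM G X → (X : Set V) ⊆ Set.range φ →
        ∃ M : (G.comap φ).Subgraph, M.IsMatching ∧ M.verts = φ ⁻¹' X by
      obtain ⟨M, hM, hv⟩ := this _ h (by simp)
      exact ⟨M, hM, fun v => by simp [hv]⟩
    intro X hX hr
    clear h
    induction hX with
    | empty => exact ⟨⊥, by simp [SimpleGraph.Subgraph.IsMatching], by simp⟩
    | @pair a b B hab ha hb _ ih =>
      simp only [coe_insert, Set.insert_subset_iff] at hr
      obtain ⟨⟨a, rfl⟩, ⟨b, rfl⟩, hr⟩ := hr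
      obtain ⟨M, hM, hv⟩ := ih hr
      have hab' : (G.comap φ).Adj a b := hab
      refine ⟨(G.comap φ).subgraphOfAdj hab' ⊔ M,
        (SimpleGraph.Subgraph.IsMatching.subgraphOfAdj hab').sup hM ?_, ?_⟩
      · rw [hM.support_eq_verts, (SimpleGraph.Subgraph.IsMatching.subgraphOfAdj
          hab').support_eq_verts, hv, Set.disjoint_left]
        simp [ha, hb]
      · ext x
        simp [hv, or_assoc]

lemma isFactorCritical_iff (R : Set W) [Fintype W] [DecidablePred (· ∈ R)] :
    IsFactorCritical ((G.comap φ).induce R) ↔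
      ∀ x ∈ R, PM G (((univ.filter (· ∈ R)).map φ).erase (φ x)) := by
  classical
  have key : ∀ x : R, ((univ.filter (· ∈ R)).map φ).erase (φ x) = univ.map
      (((Function.Embedding.subtype (· ∈ {y : R | y ≠ x})).trans
        (Function.Embedding.subtype (· ∈ R))).trans φ) := by
    intro x
    ext v
    simp only [mem_erase, mem_map, mem_filter, mem_univ, true_and]
    constructor
    · rintro ⟨hne, y, hy, rfl⟩
      exact ⟨⟨⟨y, hy⟩, fun h => hne (by rw [← h])⟩, rfl⟩
    · rintro ⟨⟨⟨y, hy⟩, hne⟩, rfl⟩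
      refine ⟨fun h => hne (Subtype.ext (φ.injective h)), y, hy, rfl⟩
  refine ⟨fun h x hx => ?_, fun h x => ?_⟩
  · rw [key ⟨x, hx⟩, ← pm_iff_exists_isPerfectMatching]
    exact h ⟨x, hx⟩
  · have := h x x.2
    rw [key x, ← pm_iff_exists_isPerfectMatching] at this
    exact this

lemma isSun_comap_iff [Fintype W] : IsSun (G.comap φ) ↔ SunOn G (univ.map φ) := by
  classical
  constructor
  · rintro (h | ⟨h, hK⟩ | ⟨R, p, hfc, hp, hp'⟩)
    · rw [Nat.card_eq_one_iff_unique] at h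
      obtain ⟨_, ⟨x⟩⟩ := h
      refine .inl ⟨φ x, ?_⟩
      ext v
      simp only [mem_map, mem_univ, true_and, mem_singleton]
      exact ⟨fun ⟨y, hy⟩ => by rw [← hy, Subsingleton.elim y x], fun h => ⟨x, h.symm⟩⟩
    · rw [Nat.card_eq_fintype_card, ← card_univ, card_eq_two] at h
      obtain ⟨a, b, hab, hu⟩ := h
      have hadj : G.Adj (φ a) (φ b) := hK a b hab
      refine IsCore.sunOn (R := {φ a}) (w := fun _ => φ b) ⟨?_, by simp, ?_, ?_, ?_, ?_⟩
      · rw [hu]; simp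
      · simpa using hadj.ne.symm
      · simpa using hadj
      · simp [hu]
      · simpa using PM.empty
    · refine .inr ⟨(univ.filter (· ∈ R)).map φ, map_subset_map.2 (subset_univ _), ?_, ?_, ?_⟩
      · intro r hr
        obtain ⟨v, hv, rfl⟩ := mem_map.1 hr
        have hv : v ∈ R := by simpa using hv
        refine ⟨φ (p ⟨v, hv⟩), by
          simpa using Set.notMem_of_mem_compl (p ⟨v, hv⟩).2, ⟨hp ⟨v, hv⟩, ?_⟩, ?_⟩
        · intro x hx hvx
          obtain ⟨x, -, rfl⟩ := mem_map.1 hx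
          have := (hp' _ _).1 hvx
          simpa using this
        · intro y hy hvy
          simp only [mem_sdiff, mem_map, mem_filter, mem_univ, true_and] at hy
          obtain ⟨⟨u, rfl⟩, hu⟩ := hy
          have hu : u ∈ Rᶜ := fun h => hu ⟨u, h, rfl⟩
          have : v = p.symm ⟨u, hu⟩ := (hp' ⟨u, hu⟩ v).1 hvy.symm
          have : (⟨v, hv⟩ : R) = p.symm ⟨u, hu⟩ := Subtype.ext this
          rw [this, Equiv.apply_symm_apply]
      · intro y hy
        simp only [mem_sdiff, mem_map, mem_filter, mem_univ, true_and] at hy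
        obtain ⟨⟨u, rfl⟩, hu⟩ := hy
        have hu : u ∈ Rᶜ := fun h => hu ⟨u, h, rfl⟩
        refine ⟨φ (p.symm ⟨u, hu⟩), by simp,
          SimpleGraph.Adj.symm ((hp' ⟨u, hu⟩ _).2 rfl), ?_⟩
        intro x hx hux
        obtain ⟨x, -, rfl⟩ := mem_map.1 hx
        rw [(hp' ⟨u, hu⟩ x).1 hux]
      · intro r hr
        obtain ⟨v, hv, rfl⟩ := mem_map.1 hr
        exact (isFactorCritical_iff φ R).1 hfc v (by simpa using hv)
  · rintro (⟨x, hx⟩ | ⟨R, hRC, h1, h2, h3⟩)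
    · left
      rw [Nat.card_eq_fintype_card, ← card_univ, ← card_map φ, hx, card_singleton]
    · right; right
      have hR : (univ.filter (· ∈ φ ⁻¹' R)).map φ = R := by
        ext v
        simp only [mem_map, mem_filter, mem_univ, true_and, Set.mem_preimage, mem_coe]
        constructor
        · rintro ⟨a, ha, rfl⟩
          exact ha
        · intro hv
          obtain ⟨a, -, rfl⟩ := mem_map.1 (hRC hv)
          exact ⟨a, hv, rfl⟩
      have h1' : ∀ r : φ ⁻¹' (R : Set V), ∃ y : ((φ ⁻¹' (R : Set V))ᶜ : Set W),
          Tip G (univ.map φ) (φ r) (φ y) ∧ ∀ y', φ y' ∉ R → G.Adj (φ r) (φ y') → y' = y := by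
        rintro ⟨r, hr⟩
        obtain ⟨y, hy, ht, hu⟩ := h1 (φ r) hr
        obtain ⟨hy, hyR⟩ := mem_sdiff.1 hy
        obtain ⟨y, -, rfl⟩ := mem_map.1 hy
        exact ⟨⟨y, hyR⟩, ht, fun y' hy' hry => φ.injective (hu _ (by simp [hy']) hry)⟩
      choose p hp hpu using h1'
      have hbij : Function.Bijective p := by
        constructor
        · intro a b hab
          have := (hp b).2 (φ a) (by simp) (hab ▸ (hp a).1.symm)
          exact Subtype.ext (φ.injective this)
        · rintro ⟨y, hy⟩
          obtain ⟨r, hr, ht⟩ := h2 (φ y) (by simpa using hy)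
          obtain ⟨r, -, rfl⟩ := mem_map.1 (hRC hr)
          exact ⟨⟨r, hr⟩, Subtype.ext (hpu ⟨r, hr⟩ y hy ht.1).symm⟩
      refine ⟨φ ⁻¹' R, Equiv.ofBijective p hbij, ?_, fun v => (hp v).1, ?_⟩
      · rw [isFactorCritical_iff, hR]
        exact fun x hx => h3 _ hx
      · intro u x
        obtain ⟨r, rfl⟩ := hbij.2 u
        have hr : (Equiv.ofBijective p hbij).symm (p r) = r :=
          (Equiv.ofBijective p hbij).symm_apply_apply r
        rw [hr]
        refine ⟨fun h => φ.injective ((hp r).2 (φ x) (by simp) h), ?_⟩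
        rintro rfl
        exact (hp r).1.symm

end Comap

/-! ### Connected components -/

section Component

variable [Fintype V] {G : SimpleGraph V} {S : Set V}

/-- The inclusion of a component of `G - S` into `V`. -/
def compEmb (c : (G.induce Sᶜ).ConnectedComponent) : c.supp ↪ V :=
  (Function.Embedding.subtype (· ∈ c.supp)).trans (Function.Embedding.subtype (· ∈ Sᶜ))

open Classical in
/-- The vertex set of a component of `G - S`. -/
noncomputable def compSet (c : (G.induce Sᶜ).ConnectedComponent) : Finset V :=
  univ.map (compEmb c)

lemma mem_compSet {c : (G.induce Sᶜ).ConnectedComponent} {x : V} :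
    x ∈ compSet c ↔ ∃ h : x ∈ Sᶜ, (G.induce Sᶜ).connectedComponentMk ⟨x, h⟩ = c := by
  simp only [compSet, mem_map, mem_univ, true_and]
  constructor
  · rintro ⟨⟨⟨y, hy⟩, hc⟩, rfl⟩
    exact ⟨hy, hc⟩
  · rintro ⟨h, hc⟩
    exact ⟨⟨⟨x, h⟩, hc⟩, rfl⟩

lemma isSun_iff_sunOn_compSet (c : (G.induce Sᶜ).ConnectedComponent) :
    IsSun ((G.induce Sᶜ).induce c.supp) ↔ SunOn G (compSet c) := by
  classical
  exact isSun_comap_iff (G := G) (compEmb c)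

open Classical in
lemma isComp_compSet (c : (G.induce Sᶜ).ConnectedComponent) :
    IsComp G (univ \ S.toFinset) (compSet c) := by
  refine ⟨?_, ?_, ?_, ?_⟩
  · intro x hx
    obtain ⟨h, -⟩ := mem_compSet.1 hx
    simpa using h
  · obtain ⟨⟨x, hx⟩, rfl⟩ := c.exists_rep
    exact ⟨x, mem_compSet.2 ⟨hx, rfl⟩⟩
  · rintro X hX ⟨x, hx⟩ hcl
    refine subset_antisymm hX fun y hy => ?_
    obtain ⟨hxS, hxc⟩ := mem_compSet.1 (hX hx)
    obtain ⟨hyS, hyc⟩ := mem_compSet.1 hy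
    have hr : (G.induce Sᶜ).Reachable ⟨x, hxS⟩ ⟨y, hyS⟩ :=
      SimpleGraph.ConnectedComponent.exact (hxc.trans hyc.symm)
    refine mem_of_reachable (X := {v : (Sᶜ : Set V) | (v : V) ∈ X}) ?_ hx hr
    rintro ⟨a, ha⟩ haX ⟨b, hb⟩ hab
    refine hcl a haX b (mem_compSet.2 ⟨hb, ?_⟩) hab
    obtain ⟨_, hac⟩ := mem_compSet.1 (hX haX)
    rw [← hac]
    exact SimpleGraph.ConnectedComponent.sound hab.reachable.symm
  · intro x hx y hy hxy
    obtain ⟨hxS, hxc⟩ := mem_compSet.1 hx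
    have hyS : y ∈ Sᶜ := by simpa using hy
    refine mem_compSet.2 ⟨hyS, ?_⟩
    rw [← hxc]
    have : (G.induce Sᶜ).Adj ⟨y, hyS⟩ ⟨x, hxS⟩ := hxy.symm
    exact SimpleGraph.ConnectedComponent.sound this.reachable

open Classical in
lemma sunCount_eq : sunCount G S = (suns G (univ \ S.toFinset)).card := by
  rw [← Fintype.card_coe, ← Nat.card_eq_fintype_card]
  refine Nat.card_eq_of_bijective (fun c => ⟨compSet c.1, mem_suns.2
    ⟨isComp_compSet c.1, (isSun_iff_sunOn_compSet c.1).1 c.2⟩⟩) ⟨?_, ?_⟩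
  · rintro ⟨c, hc⟩ ⟨d, hd⟩ hcd
    have hcd : compSet c = compSet d := congrArg Subtype.val hcd
    obtain ⟨x, hx⟩ := (isComp_compSet c).nonempty
    obtain ⟨_, rfl⟩ := mem_compSet.1 hx
    rw [hcd] at hx
    obtain ⟨_, rfl⟩ := mem_compSet.1 hx
    rfl
  · rintro ⟨C, hC⟩
    obtain ⟨hC, hsun⟩ := mem_suns.1 hC
    obtain ⟨x, hx⟩ := hC.nonempty
    have hxS : x ∈ Sᶜ := by simpa using hC.subset hx
    have : compSet ((G.induce Sᶜ).connectedComponentMk ⟨x, hxS⟩) = C :=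
      (isComp_compSet _).eq_of_mem hC (mem_compSet.2 ⟨hxS, rfl⟩) hx
    exact ⟨⟨_, (isSun_iff_sunOn_compSet _).2 (this ▸ hsun)⟩, Subtype.ext this⟩

lemma Cov.hasPPPFactor_induce {c : (G.induce Sᶜ).ConnectedComponent} (h : Cov G (compSet c)) :
    HasPPPFactor ((G.induce Sᶜ).induce c.supp) := by
  classical
  have := h.comap (compEmb c) (by simp [compSet])
  rw [compSet] at this
  refine Cov.hasPPPFactor (G := G.comap (compEmb c)) ?_
  convert this using 1
  ext x
  simp

end Component

end SunFactor

open SunFactor in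
/-- Claim 2: if `S` maximizes `sun(G − S') − 2|S'|` over all `S' ⊆ V(G)`, then every
component `D` of `G − S` that is not a sun has a `{P₃, P₄, P₅}`-factor. -/
theorem non_sun_component_has_factor {V : Type*} [Fintype V] (G : SimpleGraph V) (S : Set V)
    (hmax : ∀ S' : Set V,
      (sunCount G S' : ℤ) - 2 * S'.ncard ≤ (sunCount G S : ℤ) - 2 * S.ncard)
    (c : (G.induce Sᶜ).ConnectedComponent)
    (hns : ¬ IsSun ((G.induce Sᶜ).induce c.supp)) :
    HasPPPFactor ((G.induce Sᶜ).induce c.supp) := by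
  classical
  rw [isSun_iff_sunOn_compSet] at hns
  refine Cov.hasPPPFactor_induce (Kan.cov fun T hT => ?_)
  have h1 := card_suns_add_le (isComp_compSet c) hns hT
  have h2 := hmax (S ∪ T)
  have h3 := Set.ncard_union_le S T
  rw [sunCount_eq, sunCount_eq, Set.toFinset_union, Finset.toFinset_coe,
    ← Finset.sup_eq_union, ← sdiff_sdiff_left] at h2
  rw [Set.ncard_coe_finset] at h3
  omega
end

section
/- Let G be a finite simple graph and let k be an integer with k ≥ χ'(G) such that the binomial coefficient C(k,d) is at least n_d for every d ∈ [δ(G), Δ(G)], where n_d is the number of vertices of degree d in G. Then every optimal edge-k-coloring φ of G is semi-vertex-distinguishing on V(G): for every subset S ⊆ {1,…,k}, at most two vertices of G have color-set equal to S under φ. -/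
/-- `φ` is a proper edge-`k`-coloring of `G`: every edge gets a color in `{1,…,k}` and
adjacent (distinct, sharing a vertex) edges get different colors. -/
def IsEdgeKColoring {V : Type*} (G : SimpleGraph V) (k : ℕ) (φ : Sym2 V → ℕ) : Prop :=
  (∀ e ∈ G.edgeSet, φ e ∈ Finset.Icc 1 k) ∧
  ∀ e₁ ∈ G.edgeSet, ∀ e₂ ∈ G.edgeSet, e₁ ≠ e₂ → (∃ v : V, v ∈ e₁ ∧ v ∈ e₂) → φ e₁ ≠ φ e₂

/-- The color-set of a vertex `v`: the set of colors appearing on edges incident with `v`. -/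
def colorSet {V : Type*} (G : SimpleGraph V) (φ : Sym2 V → ℕ) (v : V) : Set ℕ :=
  {c | ∃ e ∈ G.edgeSet, v ∈ e ∧ φ e = c}

/-- The chromatic index: the least `k` for which `G` has a proper edge-`k`-coloring. -/
noncomputable def edgeChromaticIndex {V : Type*} (G : SimpleGraph V) : ℕ :=
  sInf {k | ∃ φ : Sym2 V → ℕ, IsEdgeKColoring G k φ}

/-- `n_φ^S`: the number of vertices whose color-set under `φ` is `S`. -/
noncomputable def nColorSet {V : Type*} (G : SimpleGraph V) (φ : Sym2 V → ℕ) (S : Set ℕ) : ℕ :=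
  {v : V | colorSet G φ v = S}.ncard

/-- `∑_{S ⊆ {1,…,k}} (n_φ^S)²`, the quantity minimized by an optimal edge-`k`-coloring. -/
noncomputable def colSum {V : Type*} (G : SimpleGraph V) (k : ℕ) (φ : Sym2 V → ℕ) : ℕ :=
  ∑ S ∈ (Finset.Icc 1 k).powerset, (nColorSet G φ (↑S : Set ℕ)) ^ 2

/-- The set of colors obtained from `Z` by exchanging the colors `a` and `b`. -/
def swapColors (a b : ℕ) (Z : Finset ℕ) : Finset ℕ := Z.image (Equiv.swap a b)

theorem mem_swapColors {a b x : ℕ} {Z : Finset ℕ} :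
    x ∈ swapColors a b Z ↔ Equiv.swap a b x ∈ Z := by
  unfold swapColors
  constructor
  · intro h
    obtain ⟨y, hy, rfl⟩ := Finset.mem_image.1 h
    simpa using hy
  · intro h
    exact Finset.mem_image.2 ⟨_, h, by simp⟩

theorem swapColors_swapColors (a b : ℕ) (Z : Finset ℕ) :
    swapColors a b (swapColors a b Z) = Z := by
  ext x
  simp [mem_swapColors]

theorem card_swapColors (a b : ℕ) (Z : Finset ℕ) : (swapColors a b Z).card = Z.card :=
  Finset.card_image_of_injective _ (Equiv.injective _)

theorem swapColors_subset {a b : ℕ} {K Z : Finset ℕ} (ha : a ∈ K) (hb : b ∈ K) (hZ : Z ⊆ K) :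
    swapColors a b Z ⊆ K := by
  intro x hx
  rw [mem_swapColors, Equiv.swap_apply_def] at hx
  grind

theorem swapColors_ne_iff {a b : ℕ} {Z : Finset ℕ} :
    swapColors a b Z ≠ Z ↔ ¬ (a ∈ Z ↔ b ∈ Z) := by
  rw [not_iff_not]
  constructor
  · intro h
    rw [← h, mem_swapColors, Equiv.swap_apply_left, h]
  · intro h
    ext x
    rw [mem_swapColors, Equiv.swap_apply_def]
    grind

/-- A family of multiplicity functions on color sets is exchangeable over the palette `K` if
every excess of a color set over the result of a color swap is at most two and can be reversed
inside the family, at the cost of reversing at most one more such excess; in that case both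
excesses are equal to one. -/
def IsExchangeable (K : Finset ℕ) (F : Set (Finset ℕ → ℕ)) : Prop :=
  ∀ n ∈ F, ∀ X : Finset ℕ, ∀ a ∈ K, ∀ b ∈ K, a ∈ X → b ∉ X →
    n (swapColors a b X) < n X →
    n X ≤ n (swapColors a b X) + 2 ∧
    ∃ n' ∈ F, ∃ Y : Finset ℕ,
      (Y = X ∨ n X = n (swapColors a b X) + 1 ∧ n Y = n (swapColors a b Y) + 1) ∧
      ∀ Z, n' Z = if Z = X ∨ Z = swapColors a b X ∨ Z = Y ∨ Z = swapColors a b Y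
        then n (swapColors a b Z) else n Z

theorem swapColors_comm (a b : ℕ) (Z : Finset ℕ) : swapColors a b Z = swapColors b a Z := by
  rw [swapColors, Equiv.swap_comm, swapColors]

theorem mem_swapColors_of_mem {a b x : ℕ} {Z : Finset ℕ} (ha : a ∈ Z) (hb : b ∉ Z) :
    x ∈ swapColors a b Z ↔ x = b ∨ x ∈ Z ∧ x ≠ a := by
  rw [mem_swapColors, Equiv.swap_apply_def]
  grind

theorem sdiff_swapColors_right {S T : Finset ℕ} {a b : ℕ} (hbS : b ∈ S) (haS : a ∉ S)
    (haT : a ∈ T) : swapColors b a S \ T = (S \ T).erase b := by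
  ext x
  simp only [Finset.mem_sdiff, Finset.mem_erase, mem_swapColors_of_mem hbS haS]
  grind

/-- A color set of multiplicity at least three and one of multiplicity zero, at minimal distance:
any single swap towards each other leads to another such pair. -/
theorem IsExchangeable.swap_closest {K : Finset ℕ} {F : Set (Finset ℕ → ℕ)}
    (hF : IsExchangeable K F) {m : ℕ}
    (hmin : ∀ n ∈ F, ∀ S T : Finset ℕ, S ⊆ K → T ⊆ K → S.card = T.card → 3 ≤ n S → n T = 0 →
      m ≤ (S \ T).card)
    {n : Finset ℕ → ℕ} (hn : n ∈ F) {S T : Finset ℕ} (hS : S ⊆ K) (hT : T ⊆ K)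
    (hcard : S.card = T.card) (hnS : 3 ≤ n S) (hnT : n T = 0) (hm : (S \ T).card = m)
    {a b : ℕ} (hbS : b ∈ S) (hbT : b ∉ T) (haS : a ∉ S) (haT : a ∈ T) :
    n (swapColors b a S) = 2 ∧ n (swapColors b a T) = 1 ∧
    ∃ n' ∈ F, 3 ≤ n' (swapColors b a S) ∧ n' (swapColors b a T) = 0 ∧
      ∀ Z, Z ≠ S → Z ≠ T → Z ≠ swapColors b a S → Z ≠ swapColors b a T → n' Z = n Z := by
  have hbm : b ∈ S \ T := by simp [hbS, hbT]
  have hcl : (swapColors b a S \ T).card < m := by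
    rw [sdiff_swapColors_right hbS haS haT, ← hm]
    exact Finset.card_erase_lt_of_mem hbm
  have hS1K := swapColors_subset (hS hbS) (hT haT) hS
  have hS1card : (swapColors b a S).card = T.card := by rw [card_swapColors, hcard]
  have hS1 : n (swapColors b a S) ≤ 2 := by
    by_contra hlt
    exact absurd (hmin n hn _ _ hS1K hT hS1card (by omega) hnT) (by omega)
  obtain ⟨hle, n', hn', Y, hY, hn'Z⟩ :=
    hF n hn S b (hS hbS) a (hT haT) hbS haS (by omega)
  have hS1T : swapColors b a S ≠ T := by
    rintro h
    rw [h] at hle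
    omega
  have hn'S1 : n' (swapColors b a S) = n S := by
    rw [hn'Z, if_pos (by simp), swapColors_swapColors]
  have hn'T : n' T ≠ 0 := fun h =>
    absurd (hmin n' hn' _ _ hS1K hT hS1card (by omega) h) (by omega)
  have hST : T ≠ S := by rintro rfl; exact haS haT
  have hTY : T = Y ∨ T = swapColors b a Y := by
    by_contra hne
    rw [hn'Z, if_neg (by grind)] at hn'T
    exact hn'T hnT
  have hYS : Y ≠ S := by
    rintro rfl
    rcases hTY with h | h
    · exact hST h
    · exact hS1T h.symm
  obtain ⟨h1, h2⟩ := hY.resolve_left hYS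
  have hnT1 : n (swapColors b a T) = 1 := by
    rcases hTY with rfl | rfl
    · omega
    · rw [swapColors_swapColors]; omega
  refine ⟨by omega, hnT1, n', hn', by omega, ?_, ?_⟩
  · rw [hn'Z, if_pos, swapColors_swapColors, hnT]
    rcases hTY with rfl | rfl
    · simp
    · simp [swapColors_swapColors]
  · intro Z h1 h2 h3 h4
    rw [hn'Z, if_neg]
    rcases hTY with rfl | rfl
    · simp [*]
    · rw [swapColors_swapColors] at h4
      simp [*]

theorem IsExchangeable.eq_two_of_between {K : Finset ℕ} {F : Set (Finset ℕ → ℕ)}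
    (hF : IsExchangeable K F) {m : ℕ}
    (hmin : ∀ n ∈ F, ∀ S T : Finset ℕ, S ⊆ K → T ⊆ K → S.card = T.card → 3 ≤ n S → n T = 0 →
      m ≤ (S \ T).card) (i : ℕ) :
    ∀ n ∈ F, ∀ S T X : Finset ℕ, S ⊆ K → T ⊆ K → S.card = T.card → 3 ≤ n S → n T = 0 →
      (S \ T).card = m → S ∩ T ⊆ X → X ⊆ S ∪ T → X.card = S.card → X ≠ S → X ≠ T →
      (S \ X).card = i → n X = 2 := by
  induction i with
  | zero =>
    intro n _ S T X _ _ _ _ _ _ _ _ hXc hXS _ h0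
    rw [Finset.card_eq_zero, Finset.sdiff_eq_empty_iff_subset] at h0
    exact absurd (Finset.eq_of_subset_of_card_le h0 hXc.le).symm hXS
  | succ i ih =>
    intro n hn S T X hS hT hcard hnS hnT hm hIX hXU hXc hXS hXT hi
    obtain ⟨b, hb⟩ : (S \ X).Nonempty := Finset.card_pos.1 (by omega)
    have hXS' : (X \ S).card = (S \ X).card := Finset.card_sdiff_comm hXc
    obtain ⟨a, ha⟩ : (X \ S).Nonempty := Finset.card_pos.1 (by omega)
    rw [Finset.mem_sdiff] at ha hb
    have hbT : b ∉ T := fun h => hb.2 (hIX (by simp [hb.1, h]))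
    have haT : a ∈ T := by
      have := hXU ha.1
      grind
    obtain ⟨h2, -, n', hn', hn'S, hn'T, hn'Z⟩ :=
      hF.swap_closest hmin hn hS hT hcard hnS hnT hm hb.1 hbT ha.2 haT
    by_cases hX1 : X = swapColors b a S
    · rw [hX1, h2]
    have hXT1 : X ≠ swapColors b a T := by
      rintro rfl
      have := ha.1
      rw [mem_swapColors, Equiv.swap_apply_right] at this
      exact hbT this
    rw [← hn'Z X hXS hXT hX1 hXT1]
    have keyS := fun x => mem_swapColors_of_mem (x := x) hb.1 ha.2
    have keyT := fun x => mem_swapColors_of_mem (x := x) haT hbT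
    simp only [swapColors_comm a b] at keyT
    refine ih n' hn' (swapColors b a S) (swapColors b a T) X
      (swapColors_subset (hS hb.1) (hT haT) hS) (swapColors_subset (hS hb.1) (hT haT) hT)
      (by simp [card_swapColors, hcard]) hn'S hn'T ?_ ?_ ?_ (by rw [card_swapColors, hXc])
      hX1 hXT1 ?_
    · have : swapColors b a S \ swapColors b a T = swapColors b a (S \ T) := by
        ext x
        simp [mem_swapColors]
      rw [this, card_swapColors, hm]
    · intro x hx
      rw [Finset.mem_inter, keyS, keyT] at hx
      refine hIX ?_
      grind
    · intro x hx
      have := hXU hx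
      rw [Finset.mem_union, keyS, keyT]
      grind
    · rw [sdiff_swapColors_right hb.1 ha.2 ha.1, Finset.card_erase_of_mem (by simp [hb]), hi]
      rfl

theorem IsExchangeable.ne_zero_of_three_le {K : Finset ℕ} {F : Set (Finset ℕ → ℕ)}
    (hF : IsExchangeable K F) {n : Finset ℕ → ℕ} (hn : n ∈ F) {S T : Finset ℕ}
    (hS : S ⊆ K) (hT : T ⊆ K) (hcard : S.card = T.card) (hnS : 3 ≤ n S) : n T ≠ 0 := by
  intro hnT
  induction hm : (S \ T).card using Nat.strong_induction_on generalizing n S T with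
  | _ m ih =>
  have hmin : ∀ n ∈ F, ∀ S T : Finset ℕ, S ⊆ K → T ⊆ K → S.card = T.card → 3 ≤ n S → n T = 0 →
      m ≤ (S \ T).card := by
    intro n hn S T hS hT hc h3 h0
    by_contra hlt
    exact ih _ (by omega) hn hS hT hc h3 h0 rfl
  have hST : S ≠ T := by rintro rfl; omega
  have hne : (S \ T).Nonempty := by
    rw [Finset.nonempty_iff_ne_empty, Ne, Finset.sdiff_eq_empty_iff_subset]
    exact fun h => hST (Finset.eq_of_subset_of_card_le h hcard.ge)
  obtain ⟨b, hb⟩ := hne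
  obtain ⟨a, ha⟩ : (T \ S).Nonempty := by
    rw [← Finset.card_pos, Finset.card_sdiff_comm hcard.symm]
    exact Finset.card_pos.2 ⟨b, hb⟩
  rw [Finset.mem_sdiff] at ha hb
  obtain ⟨-, h1, -⟩ := hF.swap_closest hmin hn hS hT hcard hnS hnT hm hb.1 hb.2 ha.2 ha.1
  have key := fun x => mem_swapColors_of_mem (x := x) ha.1 hb.2
  simp only [swapColors_comm a b] at key
  have h2 := hF.eq_two_of_between hmin _ n hn S T (swapColors b a T) hS hT hcard hnS hnT hm
    (by intro x hx; rw [key]; grind) (by intro x hx; rw [key] at hx; grind)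
    (by rw [card_swapColors, hcard]) (by intro h; rw [h] at h1; omega)
    (by intro h; rw [h] at h1; omega) rfl
  omega

/-- In a graph of maximum degree at most two, the component of a vertex of degree one contains
exactly one other vertex of degree one. -/
theorem exists_other_end {V : Type*} [Fintype V] (H : SimpleGraph V) [DecidableRel H.Adj]
    (hdeg : ∀ v, H.degree v ≤ 2) {v : V} (hv : H.degree v = 1) :
    ∃ r, r ≠ v ∧ H.Reachable v r ∧ H.degree r = 1 ∧
      ∀ s, H.Reachable v s → H.degree s = 1 → s = v ∨ s = r := by
  classical
  let C := H.connectedComponentMk v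
  have hmem : ∀ u, u ∈ C.supp ↔ H.Reachable v u := fun u => by
    rw [SimpleGraph.ConnectedComponent.mem_supp_iff, SimpleGraph.ConnectedComponent.eq]
    exact ⟨fun h => h.symm, fun h => h.symm⟩
  have hd : ∀ u : C.supp, (H.induce C.supp).degree u = H.degree u := fun u =>
    SimpleGraph.degree_induce_of_neighborSet_subset fun w hw =>
      (hmem w).2 (((hmem u).1 u.2).trans (SimpleGraph.Adj.reachable hw))
  have hconn : (H.induce C.supp).Connected := C.connected_toSimpleGraph
  have hvC : v ∈ C.supp := (hmem v).2 (SimpleGraph.Reachable.refl v)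
  obtain ⟨⟨r, hrC⟩, hrv, hr⟩ :=
    (H.induce C.supp).exists_ne_odd_degree_of_exists_odd_degree ⟨v, hvC⟩ (by rw [hd, hv]; simp)
  have hrv' : r ≠ v := fun h => hrv (Subtype.ext h)
  have hr1 : H.degree r = 1 := by
    rw [hd] at hr
    have := hdeg r
    have : H.degree r ≠ 2 := by intro h; rw [h] at hr; exact absurd hr (by decide)
    have : H.degree r ≠ 0 := by intro h; rw [h] at hr; exact absurd hr (by decide)
    omega
  refine ⟨r, hrv', (hmem r).1 hrC, hr1, fun s hs hs1 => ?_⟩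
  by_contra! hne
  have hcard := hconn.card_vert_le_card_edgeSet_add_one
  rw [Nat.card_eq_fintype_card, Nat.card_eq_fintype_card, ← SimpleGraph.edgeFinset_card] at hcard
  have hsum := (H.induce C.supp).sum_degrees_eq_twice_card_edges
  have hsC := (hmem s).2 hs
  let A : Finset C.supp := {⟨v, hvC⟩, ⟨r, hrC⟩, ⟨s, hsC⟩}
  have hA : A.card = 3 := by
    rw [Finset.card_eq_three]
    exact ⟨_, _, _, by simpa using hrv'.symm, by simpa using hne.1.symm, by simpa using hne.2.symm,
      rfl⟩
  have hle : ∑ u : C.supp, ((H.induce C.supp).degree u + if u ∈ A then 1 else 0)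
      ≤ ∑ _u : C.supp, 2 := by
    refine Finset.sum_le_sum fun u _ => ?_
    rw [hd]
    split_ifs with h
    · simp only [A, Finset.mem_insert, Finset.mem_singleton] at h
      rcases h with rfl | rfl | rfl <;> simp [*]
    · simpa using hdeg u
  rw [Finset.sum_add_distrib, hsum] at hle
  simp only [Finset.sum_ite_mem, Finset.univ_inter, Finset.sum_const, smul_eq_mul, mul_one, hA,
    Finset.card_univ] at hle
  omega

/-- The color-set of a vertex, as a finite set. -/
noncomputable def colorFinset {V : Type*} [Finite V] (G : SimpleGraph V) (φ : Sym2 V → ℕ) (v : V) :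
    Finset ℕ :=
  ((Set.finite_range φ).subset (t := colorSet G φ v) (by
    rintro c ⟨e, -, -, rfl⟩; exact ⟨e, rfl⟩)).toFinset

theorem coe_colorFinset {V : Type*} [Finite V] (G : SimpleGraph V) (φ : Sym2 V → ℕ) (v : V) :
    (colorFinset G φ v : Set ℕ) = colorSet G φ v := by
  simp [colorFinset]

theorem mem_colorFinset {V : Type*} [Finite V] {G : SimpleGraph V} {φ : Sym2 V → ℕ} {v : V}
    {c : ℕ} : c ∈ colorFinset G φ v ↔ ∃ w, G.Adj v w ∧ φ s(v, w) = c := by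
  rw [← Finset.mem_coe, coe_colorFinset]
  constructor
  · rintro ⟨e, he, hv, rfl⟩
    obtain ⟨w, rfl⟩ := Sym2.mem_iff_exists.1 hv
    exact ⟨w, he, rfl⟩
  · rintro ⟨w, hw, rfl⟩
    exact ⟨_, hw, by simp, rfl⟩

theorem nColorSet_coe {V : Type*} [Fintype V] (G : SimpleGraph V) (φ : Sym2 V → ℕ)
    (Z : Finset ℕ) :
    nColorSet G φ (Z : Set ℕ) = (Finset.univ.filter fun v => colorFinset G φ v = Z).card := by
  classical
  rw [nColorSet, ← Set.ncard_coe_finset]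
  congr 1
  ext v
  simp [← coe_colorFinset]

namespace IsEdgeKColoring

variable {V : Type*} {G : SimpleGraph V} {k : ℕ} {φ : Sym2 V → ℕ}

theorem eq_of_color_eq (hφ : IsEdgeKColoring G k φ) {u v w : V} (hv : G.Adj u v) (hw : G.Adj u w)
    (h : φ s(u, v) = φ s(u, w)) : v = w := by
  by_contra hne
  exact hφ.2 _ hv _ hw (fun h' => hne (Sym2.congr_right.1 h')) ⟨u, by simp, by simp⟩ h

theorem colorFinset_subset [Finite V] (hφ : IsEdgeKColoring G k φ) (v : V) :
    colorFinset G φ v ⊆ Finset.Icc 1 k := by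
  intro c hc
  obtain ⟨w, hw, rfl⟩ := mem_colorFinset.1 hc
  exact hφ.1 _ hw

theorem card_colorFinset [Fintype V] [DecidableRel G.Adj] (hφ : IsEdgeKColoring G k φ) (v : V) :
    (colorFinset G φ v).card = G.degree v := by
  rw [← G.card_neighborFinset_eq_degree]
  refine (Finset.card_bij (fun w _ => φ s(v, w)) ?_ ?_ ?_).symm
  · intro w hw
    exact mem_colorFinset.2 ⟨w, by simpa using hw, rfl⟩
  · intro w hw w' hw' h
    exact hφ.eq_of_color_eq (by simpa using hw) (by simpa using hw') h
  · intro c hc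
    obtain ⟨w, hw, rfl⟩ := mem_colorFinset.1 hc
    exact ⟨w, by simpa using hw, rfl⟩

/-- Exchanging the colors `a` and `b` at a set of vertices closed under edges of these colors. -/
theorem exists_swap_on [Finite V] (hφ : IsEdgeKColoring G k φ) {a b : ℕ}
    (ha : a ∈ Finset.Icc 1 k) (hb : b ∈ Finset.Icc 1 k) (U : Set V) [DecidablePred (· ∈ U)]
    (hU : ∀ u w, G.Adj u w → φ s(u, w) = a ∨ φ s(u, w) = b → u ∈ U → w ∈ U) :
    ∃ φ', IsEdgeKColoring G k φ' ∧ ∀ v, colorFinset G φ' v =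
      if v ∈ U then swapColors a b (colorFinset G φ v) else colorFinset G φ v := by
  classical
  let φ' : Sym2 V → ℕ := fun e => if ∃ u ∈ e, u ∈ U then Equiv.swap a b (φ e) else φ e
  have key : ∀ v, ∀ e ∈ G.edgeSet, v ∈ e →
      φ' e = if v ∈ U then Equiv.swap a b (φ e) else φ e := by
    intro v e he hv
    obtain ⟨w, rfl⟩ := Sym2.mem_iff_exists.1 hv
    by_cases hvU : v ∈ U
    · simp [φ', hvU]
    · by_cases hwU : w ∈ U
      · have h := hU w v (SimpleGraph.Adj.symm he)
        rw [Sym2.eq_swap] at h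
        have h' := not_or.1 fun hc => hvU (h hc hwU)
        simp [φ', hvU, hwU, Equiv.swap_apply_of_ne_of_ne h'.1 h'.2]
      · simp [φ', hvU, hwU]
  refine ⟨φ', ⟨fun e he => ?_, fun e₁ h₁ e₂ h₂ hne ⟨v, hv₁, hv₂⟩ => ?_⟩, fun v => ?_⟩
  · have := hφ.1 e he
    simp only [φ', Equiv.swap_apply_def]
    split_ifs <;> assumption
  · rw [key v e₁ h₁ hv₁, key v e₂ h₂ hv₂]
    have := hφ.2 e₁ h₁ e₂ h₂ hne ⟨v, hv₁, hv₂⟩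
    split_ifs
    · simpa using this
    · exact this
  · ext c
    have : c ∈ colorFinset G φ' v ↔
        ∃ w, G.Adj v w ∧ (if v ∈ U then Equiv.swap a b (φ s(v, w)) else φ s(v, w)) = c := by
      rw [mem_colorFinset]
      refine exists_congr fun w => and_congr_right fun hw => ?_
      rw [key v _ hw (by simp)]
    rw [this]
    split_ifs with h
    · rw [mem_swapColors, mem_colorFinset]
      simp only [Equiv.swap_apply_eq_iff]
    · rw [mem_colorFinset]

end IsEdgeKColoring

/-- A maximal partial matching, given by an involution, between points whose labels are exchanged
by a color swap. -/
theorem exists_maximal_pairing {V : Type*} [Finite V] (c : V → Finset ℕ) (a b : ℕ) :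
    ∃ μ : V → V, Function.Involutive μ ∧
      (∀ v, μ v ≠ v → c (μ v) = swapColors a b (c v) ∧ swapColors a b (c v) ≠ c v) ∧
      ∀ v w, μ v = v → μ w = w → swapColors a b (c v) ≠ c v → c w ≠ swapColors a b (c v) := by
  classical
  have := Fintype.ofFinite V
  let A : Finset (V → V) := Finset.univ.filter fun μ => Function.Involutive μ ∧
    ∀ v, μ v ≠ v → c (μ v) = swapColors a b (c v) ∧ swapColors a b (c v) ≠ c v
  obtain ⟨μ, hμ, hmax⟩ := A.exists_max_image (fun μ => (Finset.univ.filter fun v => μ v ≠ v).card)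
    ⟨id, Finset.mem_filter.2 ⟨Finset.mem_univ _, fun _ => rfl, fun v hv => absurd rfl hv⟩⟩
  simp only [A, Finset.mem_filter, Finset.mem_univ, true_and] at hμ hmax
  refine ⟨μ, hμ.1, hμ.2, fun v w hv hw hne hcw => ?_⟩
  have hvw : v ≠ w := by rintro rfl; exact hne hcw.symm
  let ν : V → V := fun u => if u = v then w else if u = w then v else μ u
  have hνv : ν v = w := by simp [ν]
  have hνw : ν w = v := by simp [ν, hvw.symm]
  have hν : ∀ u, u ≠ v → u ≠ w → ν u = μ u := fun u h1 h2 => by simp [ν, h1, h2]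
  have hμv : ∀ u, u ≠ v → μ u ≠ v := fun u hu h => hu (by rw [← hμ.1 u, h, hv])
  have hμw : ∀ u, u ≠ w → μ u ≠ w := fun u hu h => hu (by rw [← hμ.1 u, h, hw])
  have hνA : Function.Involutive ν ∧
      ∀ v, ν v ≠ v → c (ν v) = swapColors a b (c v) ∧ swapColors a b (c v) ≠ c v := by
    refine ⟨fun u => ?_, fun u hu => ?_⟩
    · by_cases h1 : u = v
      · rw [h1, hνv, hνw]
      by_cases h2 : u = w
      · rw [h2, hνw, hνv]
      rw [hν u h1 h2, hν _ (hμv u h1) (hμw u h2), hμ.1 u]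
    · by_cases h1 : u = v
      · subst h1; rw [hνv]; exact ⟨hcw, hne⟩
      by_cases h2 : u = w
      · subst h2; rw [hνw, hcw, swapColors_swapColors]; exact ⟨rfl, hne.symm⟩
      rw [hν u h1 h2] at hu ⊢
      exact hμ.2 u hu
  refine absurd (hmax ν hνA) (not_le.2 (Finset.card_lt_card ?_))
  rw [Finset.ssubset_iff_of_subset]
  · exact ⟨v, by simpa [hνv] using hvw.symm, by simp [hv]⟩
  · intro u hu
    simp only [Finset.mem_filter, Finset.mem_univ, true_and] at hu ⊢
    rwa [hν u (by rintro rfl; exact hu hv) (by rintro rfl; exact hu hw)]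

/-- The graph formed by the edges of colors `a` and `b` together with the pairs of `μ`. -/
def kempeGraph {V : Type*} (G : SimpleGraph V) (φ : Sym2 V → ℕ) (a b : ℕ) (μ : V → V)
    (hμ : Function.Involutive μ) : SimpleGraph V where
  Adj u v := (G.Adj u v ∧ (φ s(u, v) = a ∨ φ s(u, v) = b)) ∨ (u ≠ v ∧ μ u = v)
  symm := ⟨by
    rintro u v (⟨h, hc⟩ | ⟨h, rfl⟩)
    · exact Or.inl ⟨h.symm, by rwa [Sym2.eq_swap]⟩
    · exact Or.inr ⟨h.symm, hμ u⟩⟩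
  loopless := ⟨by
    rintro u (⟨h, -⟩ | ⟨h, -⟩)
    · exact G.loopless.irrefl u h
    · exact h rfl⟩

open Classical in
theorem degree_kempeGraph {V : Type*} [Fintype V] {G : SimpleGraph V} {k : ℕ} {φ : Sym2 V → ℕ}
    (hφ : IsEdgeKColoring G k φ) {a b : ℕ} (hab : a ≠ b) {μ : V → V}
    (hμ : Function.Involutive μ)
    (hμc : ∀ v, μ v ≠ v → colorFinset G φ (μ v) = swapColors a b (colorFinset G φ v) ∧
      swapColors a b (colorFinset G φ v) ≠ colorFinset G φ v) (u : V) :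
    (kempeGraph G φ a b μ hμ).degree u = (if a ∈ colorFinset G φ u then 1 else 0) +
      (if b ∈ colorFinset G φ u then 1 else 0) + (if μ u = u then 0 else 1) := by
  have hcol : ∀ c, (Finset.univ.filter fun w => G.Adj u w ∧ φ s(u, w) = c).card =
      if c ∈ colorFinset G φ u then 1 else 0 := by
    intro c
    split_ifs with h
    · obtain ⟨w, hw, rfl⟩ := mem_colorFinset.1 h
      rw [Finset.card_eq_one]
      refine ⟨w, ?_⟩
      ext x
      simp only [Finset.mem_filter, Finset.mem_univ, true_and, Finset.mem_singleton]
      exact ⟨fun hx => hφ.eq_of_color_eq hx.1 hw hx.2, by rintro rfl; exact ⟨hw, rfl⟩⟩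
    · rw [Finset.card_eq_zero, Finset.filter_eq_empty_iff]
      exact fun w _ hw => h (mem_colorFinset.2 ⟨w, hw⟩)
  have hpair : (Finset.univ.filter fun w => u ≠ w ∧ μ u = w).card = if μ u = u then 0 else 1 := by
    split_ifs with h
    · rw [Finset.card_eq_zero, Finset.filter_eq_empty_iff]
      rintro w - ⟨h1, h2⟩
      exact h1 (h.symm.trans h2)
    · rw [Finset.card_eq_one]
      refine ⟨μ u, ?_⟩
      ext x
      simp only [Finset.mem_filter, Finset.mem_univ, true_and, Finset.mem_singleton]
      exact ⟨fun hx => hx.2.symm, by rintro rfl; exact ⟨fun hx => h hx.symm, rfl⟩⟩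
  rw [← hcol, ← hcol, ← hpair, ← SimpleGraph.card_neighborFinset_eq_degree,
    ← Finset.card_union_of_disjoint, ← Finset.card_union_of_disjoint]
  · congr 1
    ext w
    simp only [SimpleGraph.mem_neighborFinset, Finset.mem_union, Finset.mem_filter,
      Finset.mem_univ, true_and]
    simp only [kempeGraph]
    tauto
  · rw [Finset.disjoint_left]
    intro w hw hw'
    simp only [Finset.mem_union, Finset.mem_filter, Finset.mem_univ, true_and] at hw hw'
    obtain ⟨hne, rfl⟩ := hw'
    obtain ⟨h1, h2⟩ := hμc u hne.symm
    rw [swapColors_ne_iff] at h2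
    have hu : ∀ c, (G.Adj u (μ u) ∧ φ s(u, μ u) = c) →
        c ∈ colorFinset G φ u ∧ c ∈ swapColors a b (colorFinset G φ u) := by
      rintro c ⟨h, hc⟩
      rw [← h1]
      exact ⟨mem_colorFinset.2 ⟨_, h, hc⟩, mem_colorFinset.2 ⟨_, h.symm, by rwa [Sym2.eq_swap]⟩⟩
    rcases hw with hw | hw
    · have := hu _ hw
      rw [mem_swapColors, Equiv.swap_apply_left] at this
      tauto
    · have := hu _ hw
      rw [mem_swapColors, Equiv.swap_apply_right] at this
      tauto
  · rw [Finset.disjoint_left]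
    intro w hw hw'
    simp only [Finset.mem_filter, Finset.mem_univ, true_and] at hw hw'
    exact hab (hw.2.symm.trans hw'.2)

theorem card_pairing_add_le {V : Type*} [Fintype V] {c : V → Finset ℕ} {a b : ℕ} {μ : V → V}
    (hμ : Function.Involutive μ)
    (hμc : ∀ v, μ v ≠ v → c (μ v) = swapColors a b (c v) ∧ swapColors a b (c v) ≠ c v)
    (hmax : ∀ v w, μ v = v → μ w = w → swapColors a b (c v) ≠ c v → c w ≠ swapColors a b (c v))
    {Y : Finset ℕ} (hY : swapColors a b Y ≠ Y) {W : Finset V} (hW : W.Nonempty)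
    (hWY : ∀ w ∈ W, c w = Y ∧ μ w = w) :
    (Finset.univ.filter fun v => c v = swapColors a b Y).card + W.card ≤
      (Finset.univ.filter fun v => c v = Y).card := by
  classical
  obtain ⟨r, hr⟩ := hW
  obtain ⟨rfl, hrμ⟩ := hWY r hr
  rw [← Finset.card_image_of_injective _ hμ.injective, ← Finset.card_union_of_disjoint]
  · refine Finset.card_le_card fun u hu => ?_
    simp only [Finset.mem_union, Finset.mem_image, Finset.mem_filter, Finset.mem_univ,
      true_and] at hu ⊢
    rcases hu with ⟨w, hw, rfl⟩ | hu
    · have hwμ : μ w ≠ w := fun h => hmax r w hrμ h hY hw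
      rw [(hμc w hwμ).1, hw, swapColors_swapColors]
    · exact (hWY u hu).1
  · rw [Finset.disjoint_left]
    intro u hu huW
    simp only [Finset.mem_image, Finset.mem_filter, Finset.mem_univ, true_and] at hu
    obtain ⟨w, hw, rfl⟩ := hu
    have h := (hWY _ huW).2
    have hwμ : w = μ w := (hμ w).symm.trans h
    have h1 := (hWY _ huW).1
    rw [← hwμ, hw] at h1
    exact hY h1

/-- If a color set occurs more often than its image under a color swap, then some recoloring has,
up to a permutation of the vertices, the effect of swapping two colors at only two vertices. -/
theorem IsEdgeKColoring.exists_exchange {V : Type*} [Fintype V] {G : SimpleGraph V} {k : ℕ}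
    {φ : Sym2 V → ℕ} (hφ : IsEdgeKColoring G k φ) {a b : ℕ} (ha : a ∈ Finset.Icc 1 k)
    (hb : b ∈ Finset.Icc 1 k) (hab : a ≠ b) {X : Finset ℕ} (hX : swapColors a b X ≠ X)
    (hlt : nColorSet G φ (swapColors a b X : Finset ℕ) < nColorSet G φ (X : Set ℕ)) :
    ∃ φ', IsEdgeKColoring G k φ' ∧ ∃ v r, r ≠ v ∧ colorFinset G φ v = X ∧
      swapColors a b (colorFinset G φ r) ≠ colorFinset G φ r ∧
      nColorSet G φ (swapColors a b (colorFinset G φ r) : Finset ℕ) <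
        nColorSet G φ (colorFinset G φ r : Set ℕ) ∧
      (colorFinset G φ r = X →
        nColorSet G φ (swapColors a b X : Finset ℕ) + 2 ≤ nColorSet G φ (X : Set ℕ)) ∧
      ∃ σ : Equiv.Perm V, ∀ u, (u = v ∨ u = r →
          colorFinset G φ' (σ u) = swapColors a b (colorFinset G φ u)) ∧
        (u ≠ v → u ≠ r → colorFinset G φ' (σ u) = colorFinset G φ u) := by
  classical
  simp only [nColorSet_coe] at hlt ⊢
  obtain ⟨μ, hμ, hμc, hmax⟩ := exists_maximal_pairing (colorFinset G φ) a b
  have hdeg := degree_kempeGraph hφ hab hμ hμc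
  set H := kempeGraph G φ a b μ hμ with hH
  have hdeg2 : ∀ u, H.degree u ≤ 2 := by
    intro u
    rw [hdeg]
    by_cases hu : μ u = u
    · split_ifs <;> omega
    · have := swapColors_ne_iff.1 (hμc u hu).2
      split_ifs <;> first | omega | tauto
  have hdeg1 : ∀ u, H.degree u = 1 ↔
      swapColors a b (colorFinset G φ u) ≠ colorFinset G φ u ∧ μ u = u := by
    intro u
    rw [hdeg]
    by_cases hu : μ u = u
    · rw [swapColors_ne_iff]
      split_ifs <;> simp [*]
    · have := swapColors_ne_iff.1 (hμc u hu).2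
      split_ifs <;> tauto
  obtain ⟨v, hvX, hvμ⟩ : ∃ v, colorFinset G φ v = X ∧ μ v = v := by
    by_contra! hne
    refine absurd hlt (not_lt.2 (Finset.card_le_card_of_injOn μ ?_ hμ.injective.injOn))
    intro u hu
    simp only [Finset.coe_filter, Finset.mem_univ, true_and, Set.mem_ofPred_eq] at hu ⊢
    rw [(hμc u (hne u hu)).1, hu]
  obtain ⟨r, hrv, hvr, hr, huniq⟩ := exists_other_end H hdeg2 ((hdeg1 v).2 ⟨by rwa [hvX], hvμ⟩)
  obtain ⟨hrY, hrμ⟩ := (hdeg1 r).1 hr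
  obtain ⟨φ', hφ', hc⟩ := hφ.exists_swap_on ha hb {u | H.Reachable v u} (by
    intro u w huw hcol hu
    exact SimpleGraph.Reachable.trans hu (SimpleGraph.Adj.reachable (Or.inl ⟨huw, hcol⟩)))
  simp only [Set.mem_ofPred_eq] at hc
  have hUμ : ∀ u, H.Reachable v u → H.Reachable v (μ u) := by
    intro u hu
    by_cases h : μ u = u
    · rwa [h]
    · exact hu.trans (SimpleGraph.Adj.reachable (Or.inr ⟨Ne.symm h, rfl⟩))
  let f : V → V := fun u => if H.Reachable v u then μ u else u
  have hf : Function.Involutive f := by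
    intro u
    by_cases h : H.Reachable v u
    · simp [f, h, hUμ u h, hμ u]
    · simp [f, h]
  refine ⟨φ', hφ', v, r, hrv, hvX, hrY, ?_, ?_, hf.toPerm f, fun u => ⟨?_, fun huv hur => ?_⟩⟩
  · exact card_pairing_add_le hμ hμc hmax hrY (W := {r}) (by simp) (by simp [hrμ])
  · intro hrX
    have := card_pairing_add_le hμ hμc hmax hX (W := {v, r}) (by simp)
      (by simp [hrμ, hvμ, hrX, hvX])
    rwa [Finset.card_pair hrv.symm] at this
  · rintro (rfl | rfl)
    · simp [f, hvμ, hc]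
    · simp [f, hrμ, hc, hvr]
  · rw [Function.Involutive.coe_toPerm]
    by_cases h : H.Reachable v u
    · simp only [f, h, if_true]
      rw [hc, if_pos (hUμ u h)]
      by_cases hu : μ u = u
      · rw [hu]
        by_contra hne
        rcases huniq u h ((hdeg1 u).2 ⟨hne, hu⟩) with h | h
        · exact huv h
        · exact hur h
      · rw [(hμc u hu).1, swapColors_swapColors]
    · simp [f, h, hc]

theorem card_filter_eq_of_eqOn_off_pair {V α : Type*} [Fintype V] [DecidableEq α] {c d : V → α}
    {σ : Equiv.Perm V} {v r : V} (hrv : r ≠ v) (h : ∀ u, u ≠ v → u ≠ r → d (σ u) = c u) (z : α) :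
    (Finset.univ.filter fun u => d u = z).card + (if z = c v then 1 else 0) +
        (if z = c r then 1 else 0) =
      (Finset.univ.filter fun u => c u = z).card + (if z = d (σ v) then 1 else 0) +
        (if z = d (σ r) then 1 else 0) := by
  classical
  have split : ∀ g : V → α, (Finset.univ.filter fun u => g u = z).card =
      (if z = g v then 1 else 0) + ((if z = g r then 1 else 0) +
        ∑ u ∈ (Finset.univ.erase v).erase r, if g u = z then 1 else 0) := by
    intro g
    rw [Finset.card_filter, ← Finset.add_sum_erase _ _ (Finset.mem_univ v),
      ← Finset.add_sum_erase _ _ (show r ∈ Finset.univ.erase v by simp [hrv])]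
    simp only [eq_comm]
  have hperm : (Finset.univ.filter fun u => d u = z).card =
      (Finset.univ.filter fun u => d (σ u) = z).card := by
    rw [Finset.card_filter, Finset.card_filter]
    exact (Equiv.sum_comp σ fun u => if d u = z then 1 else 0).symm
  rw [hperm, split c, split fun u => d (σ u)]
  have : ∑ u ∈ (Finset.univ.erase v).erase r, (if d (σ u) = z then 1 else 0) =
      ∑ u ∈ (Finset.univ.erase v).erase r, if c u = z then 1 else 0 := by
    refine Finset.sum_congr rfl fun u hu => ?_
    simp only [Finset.mem_erase, Finset.mem_univ, and_true] at hu
    rw [h u hu.2 hu.1]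
  omega

theorem sum_sq_sub_sum_sq_of_transfer {α : Type*} [DecidableEq α] {s : Finset α} {n n' : α → ℕ}
    {x x' y y' : α} (hx : x ∈ s) (hx' : x' ∈ s) (hy : y ∈ s) (hy' : y' ∈ s)
    (h : ∀ z, n' z + (if z = x then 1 else 0) + (if z = y then 1 else 0) =
      n z + (if z = x' then 1 else 0) + (if z = y' then 1 else 0)) :
    ((∑ z ∈ s, n' z ^ 2 : ℕ) : ℤ) - (∑ z ∈ s, n z ^ 2 : ℕ) =
      (n x' + n' x') + (n y' + n' y') - (n x + n' x) - (n y + n' y) := by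
  push_cast
  rw [← Finset.sum_sub_distrib]
  have key : ∀ z, (n' z : ℤ) ^ 2 - (n z : ℤ) ^ 2 =
      (if z = x' then ((n z : ℤ) + n' z) else 0) + (if z = y' then ((n z : ℤ) + n' z) else 0) -
      (if z = x then ((n z : ℤ) + n' z) else 0) - (if z = y then ((n z : ℤ) + n' z) else 0) := by
    intro z
    have hz : (n' z : ℤ) = n z + (if z = x' then 1 else 0) + (if z = y' then 1 else 0) -
        (if z = x then 1 else 0) - (if z = y then 1 else 0) := by
      have := congrArg (Nat.cast : ℕ → ℤ) (h z)
      push_cast at this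
      linarith
    have e : ∀ p : Prop, ∀ [Decidable p], (if p then ((n z : ℤ) + n' z) else 0) =
        (if p then 1 else 0) * ((n z : ℤ) + n' z) := by
      intro p _
      split_ifs <;> simp
    rw [e, e, e, e]
    linear_combination ((n' z : ℤ) + n z) * hz
  simp only [key, Finset.sum_add_distrib, Finset.sum_sub_distrib, Finset.sum_ite_eq', hx, hx', hy,
    hy', if_true]

/-- The multiplicity functions of the optimal edge colorings form an exchangeable family. -/
theorem isExchangeable_optimal {V : Type*} [Fintype V] (G : SimpleGraph V) (k : ℕ) :
    IsExchangeable (Finset.Icc 1 k) {n | ∃ φ, IsEdgeKColoring G k φ ∧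
      (∀ φ', IsEdgeKColoring G k φ' → colSum G k φ ≤ colSum G k φ') ∧
      n = fun Z : Finset ℕ => nColorSet G φ (Z : Set ℕ)} := by
  classical
  rintro _ ⟨φ, hφ, hopt, rfl⟩ X a ha b hb haX hbX hlt
  have hX : swapColors a b X ≠ X := by rw [swapColors_ne_iff]; tauto
  obtain ⟨φ', hφ', v, r, hrv, hvX, hrY, hY, hYX, σ, hσ⟩ :=
    hφ.exists_exchange ha hb (by rintro rfl; exact hbX haX) hX hlt
  set Y := colorFinset G φ r with hYdef
  have htr : ∀ Z : Finset ℕ, nColorSet G φ' (Z : Set ℕ) + (if Z = X then 1 else 0) +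
      (if Z = Y then 1 else 0) = nColorSet G φ (Z : Set ℕ) +
      (if Z = swapColors a b X then 1 else 0) + (if Z = swapColors a b Y then 1 else 0) := by
    intro Z
    have := card_filter_eq_of_eqOn_off_pair hrv (fun u => (hσ u).2) Z
    rwa [(hσ v).1 (Or.inl rfl), (hσ r).1 (Or.inr rfl), hvX, ← nColorSet_coe,
      ← nColorSet_coe] at this
  have hXK : X ⊆ Finset.Icc 1 k := hvX ▸ hφ.colorFinset_subset v
  have hYK : Y ⊆ Finset.Icc 1 k := hφ.colorFinset_subset r
  have hsum := sum_sq_sub_sum_sq_of_transfer (s := (Finset.Icc 1 k).powerset)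
    (Finset.mem_powerset.2 hXK) (Finset.mem_powerset.2 (swapColors_subset ha hb hXK))
    (Finset.mem_powerset.2 hYK) (Finset.mem_powerset.2 (swapColors_subset ha hb hYK)) htr
  have hle := hopt φ' hφ'
  change ((colSum G k φ' : ℕ) : ℤ) - (colSum G k φ : ℕ) = _ at hsum
  simp only at hlt ⊢
  have opt' : colSum G k φ' = colSum G k φ →
      ∀ ψ, IsEdgeKColoring G k ψ → colSum G k φ' ≤ colSum G k ψ :=
    fun h ψ hψ => h ▸ hopt ψ hψ
  have t1 := htr X
  have t2 := htr (swapColors a b X)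
  have t3 := htr Y
  have t4 := htr (swapColors a b Y)
  by_cases hXY : Y = X
  · clear_value Y
    subst hXY
    simp only [if_true, hX, hX.symm, if_false] at t1 t2
    have h2 := hYX rfl
    refine ⟨by omega, _, ⟨φ', hφ', opt' (by omega), rfl⟩, Y, Or.inl rfl, fun Z => ?_⟩
    split_ifs with hZ
    · rcases hZ with rfl | rfl | rfl | rfl <;> (try rw [swapColors_swapColors]) <;> omega
    · have := htr Z
      simp only [not_or] at hZ
      simpa [hZ.1, hZ.2.1] using this
  · have hXY' : Y ≠ swapColors a b X := by
      intro h
      rw [h, swapColors_swapColors] at hY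
      omega
    have hYX' : X ≠ swapColors a b Y := by
      intro h
      exact hXY' (by rw [h, swapColors_swapColors])
    have hXY'' : swapColors a b X ≠ swapColors a b Y := by
      intro h
      exact hXY (by rw [← swapColors_swapColors a b Y, ← h, swapColors_swapColors])
    simp only [if_true, hX, hX.symm, hrY, hrY.symm, hXY, Ne.symm hXY, hXY', hXY'.symm, hYX',
      hYX'.symm, hXY'', hXY''.symm, if_false] at t1 t2 t3 t4
    refine ⟨by omega, _, ⟨φ', hφ', opt' (by omega), rfl⟩, Y, Or.inr ⟨by omega, by omega⟩,
      fun Z => ?_⟩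
    split_ifs with hZ
    · rcases hZ with rfl | rfl | rfl | rfl <;> (try rw [swapColors_swapColors]) <;> omega
    · have := htr Z
      simp only [not_or] at hZ
      simpa [hZ.1, hZ.2.1, hZ.2.2.1, hZ.2.2.2] using this

/-- If `k ≥ χ'(G)` and `C(k,d) ≥ n_d` for every `d ∈ [δ(G), Δ(G)]`, then every optimal
edge-`k`-coloring `φ` of `G` is semi-vertex-distinguishing: every color-set `S ⊆ {1,…,k}`
is the color-set of at most two vertices. -/
theorem optimal_coloring_semi_vd {V : Type*} [Fintype V]
    (G : SimpleGraph V) [DecidableRel G.Adj] (k : ℕ) (hk : edgeChromaticIndex G ≤ k)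
    (hbin : ∀ d : ℕ, G.minDegree ≤ d → d ≤ G.maxDegree →
      (Finset.univ.filter (fun v => G.degree v = d)).card ≤ k.choose d)
    (φ : Sym2 V → ℕ) (hφ : IsEdgeKColoring G k φ)
    (hopt : ∀ φ' : Sym2 V → ℕ, IsEdgeKColoring G k φ' → colSum G k φ ≤ colSum G k φ') :
    ∀ S : Set ℕ, S ⊆ Set.Icc 1 k → {v : V | colorSet G φ v = S}.ncard ≤ 2 := by
  classical
  intro S hS
  by_contra! h3
  obtain ⟨S, rfl⟩ := ((Set.finite_Icc 1 k).subset hS).exists_finset_coe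
  have hSK : S ⊆ Finset.Icc 1 k := by exact_mod_cast (by simpa using hS : (S : Set ℕ) ⊆ _)
  have hF := isExchangeable_optimal G k
  have hne : ∀ T ∈ (Finset.Icc 1 k).powersetCard S.card, nColorSet G φ (T : Set ℕ) ≠ 0 := by
    intro T hT
    rw [Finset.mem_powersetCard] at hT
    exact hF.ne_zero_of_three_le ⟨φ, hφ, hopt, rfl⟩ hSK hT.1 hT.2.symm h3
  have h3' : 2 < (Finset.univ.filter fun v => colorFinset G φ v = S).card := by
    rw [← nColorSet_coe]; exact h3
  obtain ⟨u, hu, v, hv, huv⟩ := Finset.one_lt_card.1 (lt_trans one_lt_two h3')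
  simp only [Finset.mem_filter, Finset.mem_univ, true_and] at hu hv
  have hdeg : G.degree u = S.card := by rw [← hφ.card_colorFinset, hu]
  have hdeg' : G.degree v = S.card := by rw [← hφ.card_colorFinset, hv]
  have hle := hbin S.card (hdeg ▸ G.minDegree_le_degree u) (hdeg ▸ G.degree_le_maxDegree u)
  refine huv (Finset.injOn_of_surjOn_of_card_le
    (s := Finset.univ.filter fun v => G.degree v = S.card) (t := (Finset.Icc 1 k).powersetCard S.card)
    (colorFinset G φ) ?_ ?_ ?_ (by simpa using hdeg) (by simpa using hdeg') (hu.trans hv.symm))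
  · intro w hw
    simp only [Finset.coe_filter, Finset.mem_univ, true_and, Set.mem_ofPred_eq] at hw
    exact Finset.mem_powersetCard.2 ⟨hφ.colorFinset_subset w, by rw [hφ.card_colorFinset, hw]⟩
  · intro T hT
    have hT0 := hne T hT
    rw [nColorSet_coe, Finset.card_ne_zero] at hT0
    obtain ⟨w, hw⟩ := hT0
    simp only [Finset.mem_filter, Finset.mem_univ, true_and] at hw
    refine ⟨w, ?_, hw⟩
    have := (Finset.mem_powersetCard.1 hT).2
    simp [← hφ.card_colorFinset, hw, this]
  · simpa using hle
end
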